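/- For all i, j ∈ I, the identity (1 − q^{2N} t^{−2h}) · C̃_{ij}(q,t) = q^{d_j} t^{−1} · ( \overline{P_{ij}} − q^{N} t^{−h} · \overline{P_{i j^*}} ) holds in K. (This is the combinatorial form of the main theorem: it expresses the inverse of the (q,t)-deformed Cartan matrix via sums of pairings along a reduced expression of the longest element; in particular the right-hand side does not depend on the chosen reduced expression or on the choice of the μ_i.) -/

import Mathlib

noncomputable section

open scoped BigOperators

/-- The field `K = ℚ(q,t)` of rational functions in two variables over `ℚ`. -/
abbrev KK : Type := FractionRing (MvPolynomial (Fin 2) ℚ)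

/-- The variable `q` of `ℚ(q,t)`. -/
def qv : KK := algebraMap (MvPolynomial (Fin 2) ℚ) KK (MvPolynomial.X 0)

/-- The variable `t` of `ℚ(q,t)`. -/
def tv : KK := algebraMap (MvPolynomial (Fin 2) ℚ) KK (MvPolynomial.X 1)

/-- The quantum integer `[k]_q = (q^k - q^{-k})/(q - q⁻¹)` in `ℚ(q,t)`. -/
def qint (k : ℤ) : KK := (qv ^ k - qv ^ (-k)) / (qv - qv⁻¹)

variable {I : Type}

/-- The `(q,t)`-deformed Cartan matrix `C(q,t)`:
`C_{ii} = q^{d_i} t⁻¹ + q^{-d_i} t` and `C_{ij} = [c_{ij}]_q` for `i ≠ j`. -/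
def Cqt [DecidableEq I] (c : I → I → ℤ) (d : I → ℤ) (i j : I) : KK :=
  if i = j then qv ^ (d i) * tv⁻¹ + qv ^ (-(d i)) * tv else qint (c i j)

/-- The basis vector `α_i` of `V = K^{⊕I}`. -/
def alphaK [DecidableEq I] (i : I) : I → KK := Pi.single i 1

/-- The deformed bilinear form `B` on `V`, determined by
`B(α_i, α_j) = [d_i]_q C_{ij}(q,t)`. -/
def Bform [Fintype I] [DecidableEq I] (c : I → I → ℤ) (d : I → ℤ)
    (lam mu : I → KK) : KK :=
  ∑ i, ∑ j, lam i * mu j * (qint (d i) * Cqt c d i j)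

/-- The operator `T_i : V → V`, `T_i(λ) = λ - (q^{-d_i} t/[d_i]_q)·B(α_i, λ)·α_i`. -/
def Trefl [Fintype I] [DecidableEq I] (c : I → I → ℤ) (d : I → ℤ) (i : I)
    (lam : I → KK) : I → KK :=
  fun k => lam k - (qv ^ (-(d i)) * tv / qint (d i)) * Bform c d (alphaK i) lam * alphaK i k

/-- The simple reflection `s_i` on the root lattice `ℤ^{⊕I}`, with `s_i(α_j) = α_j - c_{ij} α_i`. -/
def sZ [Fintype I] [DecidableEq I] (c : I → I → ℤ) (i : I) : (I → ℤ) → (I → ℤ) :=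
  fun v k => v k - (if k = i then ∑ j, c i j * v j else 0)

/-- The simple root `α_i` of the root lattice `ℤ^{⊕I}`. -/
def alphaZ [DecidableEq I] (i : I) : I → ℤ := Pi.single i 1

/-- Membership in the Weyl group `W`, the group of automorphisms of the root lattice
generated by the simple reflections; since each simple reflection is an involution,
`W` is exactly the set of finite products of simple reflections. -/
def memW [Fintype I] [DecidableEq I] (c : I → I → ℤ) (w : (I → ℤ) → (I → ℤ)) : Prop :=
  ∃ l : List I, w = (l.map (sZ c)).foldr (· ∘ ·) id

/-- The sum `P_{ij} = Σ_{1 ≤ k ≤ l, i_k = j} B(μ_i, T_{i₁}⋯T_{i_{k-1}}(α_j))` attached to a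
reduced word `ww = (i₁, …, i_l)` and chosen deformed fundamental coweights `μ`. -/
def Pij [Fintype I] [DecidableEq I] (c : I → I → ℤ) (d : I → ℤ) (ww : List I)
    (mu : I → I → KK) (i j : I) : KK :=
  ∑ k : Fin ww.length, if ww.get k = j then
    Bform c d (mu i) ((ww.take k.1).foldr (fun a acc => Trefl c d a acc) (alphaK j)) else 0

section GenRefl
variable {ι : Type} [Fintype ι] [DecidableEq ι] {R : Type} [CommRing R]

/-- The linear form `v ↦ Σ_j A i j * v j`. -/
def rowL (A : ι → ι → R) (i : ι) : Module.Dual R (ι → R) :=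
  ∑ j, A i j • LinearMap.proj j

theorem rowL_apply (A : ι → ι → R) (i : ι) (v : ι → R) :
    rowL A i v = ∑ j, A i j * v j := by
  simp [rowL]

theorem rowL_single (A : ι → ι → R) (i j : ι) :
    rowL A i (Pi.single j 1) = A i j := by
  simp [rowL_apply, Pi.single_apply]

/-- Generic deformed reflection. -/
def gr (A : ι → ι → R) (u : ι → R) (i : ι) : Module.End R (ι → R) :=
  LinearMap.transvection (-(u i) • rowL A i) (Pi.single i 1)

theorem gr_apply (A : ι → ι → R) (u : ι → R) (i : ι) (v : ι → R) :
    gr A u i v = v - (u i * rowL A i v) • Pi.single i 1 := by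
  simp [gr, LinearMap.transvection.apply, sub_eq_add_neg]

theorem gr_apply_apply (A : ι → ι → R) (u : ι → R) (i : ι) (v : ι → R) (k : ι) :
    gr A u i v k = v k - if k = i then u i * rowL A i v else 0 := by
  simp [gr_apply, Pi.single_apply]

theorem gr_det (A : ι → ι → R) (u : ι → R) (i : ι) :
    LinearMap.det (gr A u i) = 1 - u i * A i i := by
  rw [gr, LinearMap.transvection.det]
  simp [rowL_single, sub_eq_add_neg]

/-- Word operator. -/
def gw (A : ι → ι → R) (u : ι → R) (l : List ι) : Module.End R (ι → R) :=
  (l.map (gr A u)).prod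

@[simp] theorem gw_nil (A : ι → ι → R) (u : ι → R) : gw A u [] = 1 := rfl
@[simp] theorem gw_cons (A : ι → ι → R) (u : ι → R) (i : ι) (l : List ι) :
    gw A u (i :: l) = gr A u i * gw A u l := by simp [gw]
@[simp] theorem gw_append (A : ι → ι → R) (u : ι → R) (l l' : List ι) :
    gw A u (l ++ l') = gw A u l * gw A u l' := by simp [gw]

/-- alternating word of length `k` ending in `i`. -/
def alt (i j : ι) : ℕ → List ι
  | 0 => []
  | k + 1 => alt j i k ++ [i]


theorem gr_row (A : ι → ι → R) (u : ι → R) (i j : ι) (v : ι → R) :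
    rowL A j (gr A u i v) = rowL A j v - u i * A j i * rowL A i v := by
  simp [gr_apply, map_sub, rowL_single]; ring

theorem gr_row_self (A : ι → ι → R) (u : ι → R) (i : ι) (v : ι → R)
    (hi : u i * A i i = 1 + u i ^ 2) :
    rowL A i (gr A u i v) = - u i ^ 2 * rowL A i v := by
  rw [gr_row, hi]; ring

theorem braid2 (A : ι → ι → R) (u : ι → R) (i j : ι) (hij : i ≠ j)
    (h1 : A i j = 0) (h2 : A j i = 0) :
    gw A u (alt i j 2) = gw A u (alt j i 2) := by
  refine LinearMap.ext fun v => funext fun k => ?_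
  simp only [alt, gw_append, gw_cons, gw_nil, mul_one, one_mul, Module.End.mul_apply,
    List.nil_append, gr_apply_apply, gr_row A u i j, gr_row A u j i, h1, h2]
  by_cases ki : k = i <;> by_cases kj : k = j <;> simp [ki, kj, hij, hij.symm]

theorem braid3 (A : ι → ι → R) (u : ι → R) (i j : ι) (hij : i ≠ j)
    (hu : u i = u j) (h1 : A i j * A j i = 1)
    (hi : u i * A i i = 1 + u i ^ 2) (hj : u j * A j j = 1 + u j ^ 2) :
    gw A u (alt i j 3) = gw A u (alt j i 3) := by
  have h : u i * A j i * (u j * A i j) = u i ^ 2 := by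
    linear_combination u i * u j * h1 - u i * hu
  refine LinearMap.ext fun v => funext fun k => ?_
  simp only [alt, gw_append, gw_cons, gw_nil, mul_one, one_mul, Module.End.mul_apply,
    List.nil_append, gr_apply_apply, gr_row_self A u i _ hi, gr_row_self A u j _ hj,
    gr_row A u i j, gr_row A u j i]
  generalize u i * A j i = b at h
  generalize u j * A i j = g at h
  generalize rowL A i v = x
  generalize rowL A j v = y
  generalize u i = U at hu h
  generalize u j = V at hu h
  subst hu
  by_cases ki : k = i
  · subst ki
    simp only [hij, if_true, if_false]
    grind
  · by_cases kj : k = j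
    · subst kj
      simp only [hij.symm, if_true, if_false]
      grind
    · simp [ki, kj]

theorem braid4 (A : ι → ι → R) (u : ι → R) (i j : ι) (hij : i ≠ j)
    (h : u i * A j i * (u j * A i j) = u i ^ 2 + u j ^ 2)
    (hi : u i * A i i = 1 + u i ^ 2) (hj : u j * A j j = 1 + u j ^ 2) :
    gw A u (alt i j 4) = gw A u (alt j i 4) := by
  refine LinearMap.ext fun v => funext fun k => ?_
  simp only [alt, gw_append, gw_cons, gw_nil, mul_one, one_mul, Module.End.mul_apply,
    List.nil_append, gr_apply_apply, gr_row_self A u i _ hi, gr_row_self A u j _ hj,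
    gr_row A u i j, gr_row A u j i]
  generalize u i * A j i = b at h
  generalize u j * A i j = g at h
  generalize rowL A i v = x
  generalize rowL A j v = y
  generalize u i = U at h
  generalize u j = V at h
  by_cases ki : k = i
  · subst ki
    simp only [hij, if_true, if_false]
    grind
  · by_cases kj : k = j
    · subst kj
      simp only [hij.symm, if_true, if_false]
      grind
    · simp [ki, kj]

theorem braid6 (A : ι → ι → R) (u : ι → R) (i j : ι) (hij : i ≠ j)
    (h : u i * A j i * (u j * A i j) = u i ^ 2 + u i * u j + u j ^ 2)
    (hi : u i * A i i = 1 + u i ^ 2) (hj : u j * A j j = 1 + u j ^ 2) :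
    gw A u (alt i j 6) = gw A u (alt j i 6) := by
  refine LinearMap.ext fun v => funext fun k => ?_
  simp only [alt, gw_append, gw_cons, gw_nil, mul_one, one_mul, Module.End.mul_apply,
    List.nil_append, gr_apply_apply, gr_row_self A u i _ hi, gr_row_self A u j _ hj,
    gr_row A u i j, gr_row A u j i]
  generalize u i * A j i = b at h
  generalize u j * A i j = g at h
  generalize rowL A i v = x
  generalize rowL A j v = y
  generalize u i = U at h
  generalize u j = V at h
  by_cases ki : k = i
  · subst ki
    simp only [hij, if_true, if_false]
    grind
  · by_cases kj : k = j
    · subst kj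
      simp only [hij.symm, if_true, if_false]
      grind
    · simp [ki, kj]

end GenRefl

section Cox
variable {ι : Type} [Fintype ι] [DecidableEq ι]

/-- Cartan data used throughout. -/
structure CH (c : ι → ι → ℤ) (d : ι → ℤ) : Prop where
  diag : ∀ i, c i i = 2
  dpos : ∀ i, 0 < d i
  symm : ∀ i j, d i * c i j = d j * c j i
  pair : ∀ i j, i ≠ j → (c i j = 0 ∧ c j i = 0) ∨ (d i = d j ∧ c i j = -1 ∧ c j i = -1) ∨
    (d i = 1 ∧ d j = 2 ∧ c i j = -2 ∧ c j i = -1) ∨ (d i = 2 ∧ d j = 1 ∧ c i j = -1 ∧ c j i = -2) ∨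
    (d i = 1 ∧ d j = 3 ∧ c i j = -3 ∧ c j i = -1) ∨ (d i = 3 ∧ d j = 1 ∧ c i j = -1 ∧ c j i = -3)

/-- Integral simple reflection. -/
def sg (c : ι → ι → ℤ) (i : ι) : Module.End ℤ (ι → ℤ) := gr c (fun _ => (1 : ℤ)) i
/-- Integral word operator. -/
def sw (c : ι → ι → ℤ) (l : List ι) : Module.End ℤ (ι → ℤ) := gw c (fun _ => (1 : ℤ)) l

@[simp] theorem sw_nil (c : ι → ι → ℤ) : sw c [] = 1 := rfl
@[simp] theorem sw_cons (c : ι → ι → ℤ) (i : ι) (l : List ι) :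
    sw c (i :: l) = sg c i * sw c l := gw_cons _ _ _ _
@[simp] theorem sw_append (c : ι → ι → ℤ) (l l' : List ι) :
    sw c (l ++ l') = sw c l * sw c l' := gw_append _ _ _ _
theorem sw_snoc (c : ι → ι → ℤ) (i : ι) (l : List ι) :
    sw c (l ++ [i]) = sw c l * sg c i := by simp
theorem sg_apply (c : ι → ι → ℤ) (i : ι) (v : ι → ℤ) :
    sg c i v = v - (rowL c i v) • Pi.single i 1 := by
  simp [sg, gr_apply]
theorem sg_row (c : ι → ι → ℤ) (i j : ι) (v : ι → ℤ) :
    rowL c j (sg c i v) = rowL c j v - c j i * rowL c i v := by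
  simp [sg, gr_row]

/-- Coxeter exponent. -/
def mm (c : ι → ι → ℤ) (i j : ι) : ℕ :=
  if c i j * c j i = 0 then 2 else if c i j * c j i = 1 then 3 else
    if c i j * c j i = 2 then 4 else 6

theorem mm_symm (c : ι → ι → ℤ) (i j : ι) : mm c i j = mm c j i := by
  simp only [mm, mul_comm]

theorem mm_pos (c : ι → ι → ℤ) (i j : ι) : ∃ m, mm c i j = m + 1 := by
  refine ⟨mm c i j - 1, ?_⟩
  unfold mm; split_ifs <;> rfl

theorem alt_length (i j : ι) (k : ℕ) : (alt i j k).length = k := by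
  induction k generalizing i j with
  | zero => rfl
  | succ k ih => simp [alt, ih]

theorem alt_mem (i j : ι) (k : ℕ) : ∀ a ∈ alt i j k, a = i ∨ a = j := by
  induction k generalizing i j with
  | zero => simp [alt]
  | succ k ih =>
    intro a ha
    simp only [alt, List.mem_append, List.mem_singleton] at ha
    rcases ha with ha | ha
    · exact (ih j i a ha).symm
    · exact Or.inl ha

variable {c : ι → ι → ℤ} {d : ι → ℤ}

theorem sg_sq (H : CH c d) (i : ι) : sg c i * sg c i = 1 := by
  refine LinearMap.ext fun v => ?_
  simp only [Module.End.mul_apply, Module.End.one_apply]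
  rw [sg_apply, sg_row, sg_apply, H.diag]
  ext k
  simp; ring

theorem sg_sq' (H : CH c d) (i : ι) (x : Module.End ℤ (ι → ℤ)) : sg c i * (sg c i * x) = x := by
  rw [← mul_assoc, sg_sq H, one_mul]

theorem sg_self (H : CH c d) (i : ι) : sg c i (Pi.single i 1) = - Pi.single i 1 := by
  rw [sg_apply, rowL_single, H.diag]
  ext k; simp [Pi.single_apply]; split_ifs <;> rfl

theorem sg_other (i j : ι) : sg c i (Pi.single j 1) = Pi.single j 1 - c i j • Pi.single i 1 := by
  rw [sg_apply, rowL_single]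

theorem s_braid (H : CH c d) {i j : ι} (hij : i ≠ j) :
    sw c (alt i j (mm c i j)) = sw c (alt j i (mm c i j)) := by
  have hi : (fun _ : ι => (1 : ℤ)) i * c i i = 1 + (fun _ : ι => (1 : ℤ)) i ^ 2 := by
    simp [H.diag]
  have hj : (fun _ : ι => (1 : ℤ)) j * c j j = 1 + (fun _ : ι => (1 : ℤ)) j ^ 2 := by
    simp [H.diag]
  rcases H.pair i j hij with h | h | h | h | h | h
  · have : mm c i j = 2 := by simp [mm, h]
    rw [this]; exact braid2 _ _ _ _ hij h.1 h.2
  · have : mm c i j = 3 := by simp [mm, h]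
    rw [this]; exact braid3 _ _ _ _ hij rfl (by simp [h]) hi hj
  · have : mm c i j = 4 := by simp [mm, h]
    rw [this]; exact braid4 _ _ _ _ hij (by simp [h]) hi hj
  · have : mm c i j = 4 := by simp [mm, h]
    rw [this]; exact braid4 _ _ _ _ hij (by simp [h]) hi hj
  · have : mm c i j = 6 := by simp [mm, h]
    rw [this]; exact braid6 _ _ _ _ hij (by simp [h]) hi hj
  · have : mm c i j = 6 := by simp [mm, h]
    rw [this]; exact braid6 _ _ _ _ hij (by simp [h]) hi hj

theorem s_inv (H : CH c d) (a : List ι) : sw c a.reverse * sw c a = 1 := by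
  induction a with
  | nil => simp
  | cons i a ih =>
    simp only [List.reverse_cons, sw_append, sw_cons, sw_nil, mul_one]
    rw [mul_assoc, sg_sq' H, ih]

theorem s_inv' (H : CH c d) (a : List ι) : sw c a * sw c a.reverse = 1 := by
  have := s_inv H a.reverse
  simpa using this

theorem s_inj (H : CH c d) (a : List ι) {v w : ι → ℤ} (h : sw c a v = sw c a w) : v = w := by
  have := congrArg (sw c a.reverse) h
  rwa [← Module.End.mul_apply, ← Module.End.mul_apply, s_inv H] at this

theorem s_det (H : CH c d) (a : List ι) : LinearMap.det (sw c a) = (-1) ^ a.length := by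
  induction a with
  | nil => simp
  | cons i a ih => rw [sw_cons, map_mul, ih, sg, gr_det, H.diag]; simp [pow_succ]

theorem s_parity (H : CH c d) {a b : List ι} (h : sw c a = sw c b) :
    a.length % 2 = b.length % 2 := by
  have := congrArg LinearMap.det h
  rw [s_det H, s_det H] at this
  rcases Nat.even_or_odd a.length with ha | ha <;> rcases Nat.even_or_odd b.length with hb | hb
  · rw [Nat.even_iff] at ha hb; omega
  · rw [ha.neg_one_pow, hb.neg_one_pow] at this; norm_num at this
  · rw [ha.neg_one_pow, hb.neg_one_pow] at this; norm_num at this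
  · rw [Nat.odd_iff] at ha hb; omega

/-- Reduced words. -/
def Rd (c : ι → ι → ℤ) (a : List ι) : Prop := ∀ b, sw c b = sw c a → a.length ≤ b.length

theorem exists_rd (c : ι → ι → ℤ) (a : List ι) : ∃ b, Rd c b ∧ sw c b = sw c a := by
  classical
  have hex : ∃ n, ∃ b : List ι, b.length = n ∧ sw c b = sw c a := ⟨_, a, rfl, rfl⟩
  obtain ⟨b, hb, hb'⟩ := Nat.find_spec hex
  refine ⟨b, fun e he => ?_, hb'⟩
  rw [hb]
  exact Nat.find_min' hex ⟨e, rfl, he.trans hb'⟩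

theorem Rd.left {a b : List ι} (h : Rd c (a ++ b)) : Rd c a := by
  intro e he
  have := h (e ++ b) (by simp [he])
  simpa using this

theorem Rd.congr {a b : List ι} (h : Rd c a) (hs : sw c b = sw c a) (hl : b.length = a.length) :
    Rd c b := by
  intro e he
  rw [hl]; exact h e (he.trans hs)

theorem drop_last (H : CH c d) {a : List ι} {i : ι} (ha : Rd c a) (h : ¬ Rd c (a ++ [i])) :
    ∃ b, sw c (b ++ [i]) = sw c a ∧ b.length + 1 = a.length := by
  unfold Rd at h
  push Not at h
  obtain ⟨y, hy, hl⟩ := h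
  have hp := s_parity H hy
  have h1 : sw c (y ++ [i]) = sw c a := by
    simp only [sw_append, sw_cons, sw_nil, mul_one] at hy ⊢
    rw [hy, mul_assoc, sg_sq H, mul_one]
  refine ⟨y, h1, ?_⟩
  have := ha _ h1
  simp at this hl hp
  omega

theorem decomp (H : CH c d) (i j : ι) (n : ℕ) : ∀ (e x : List ι), e.length = n →
    (∀ a ∈ x, a = i ∨ a = j) → Rd c (e ++ x) →
    ∃ e' x', e'.length ≤ n ∧ (∀ a ∈ x', a = i ∨ a = j) ∧ sw c (e' ++ x') = sw c (e ++ x) ∧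
      e'.length + x'.length = e.length + x.length ∧ Rd c (e' ++ [i]) ∧ Rd c (e' ++ [j]) := by
  induction n using Nat.strong_induction_on with
  | _ n ih =>
    intro e x hn hx hr
    by_cases h : Rd c (e ++ [i]) ∧ Rd c (e ++ [j])
    · exact ⟨e, x, hn.le, hx, rfl, rfl, h.1, h.2⟩
    · have : ∃ k, (k = i ∨ k = j) ∧ ¬ Rd c (e ++ [k]) := by
        by_cases h1 : Rd c (e ++ [i])
        · exact ⟨j, Or.inr rfl, fun h2 => h ⟨h1, h2⟩⟩
        · exact ⟨i, Or.inl rfl, h1⟩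
      obtain ⟨k, hk, hnr⟩ := this
      obtain ⟨b, hb, hbl⟩ := drop_last H hr.left hnr
      have hs : sw c (b ++ k :: x) = sw c (e ++ x) := by
        have : b ++ k :: x = (b ++ [k]) ++ x := by simp
        rw [this, sw_append, hb, sw_append]
      have hl : (b ++ k :: x).length = (e ++ x).length := by simp; omega
      obtain ⟨e', x', h1, h2, h3, h4, h5, h6⟩ := ih b.length (by omega) b (k :: x) rfl
        (by intro a ha; rcases List.mem_cons.1 ha with rfl | ha
            · exact hk
            · exact hx a ha) (hr.congr hs hl)
      refine ⟨e', x', by omega, h2, h3.trans hs, ?_, h5, h6⟩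
      simp at hl h4; omega

theorem alt_or_short (H : CH c d) {i j : ι} (hij : i ≠ j) (x : List ι) :
    (∀ a ∈ x, a = i ∨ a = j) →
    (∃ k ≤ mm c i j, x = alt i j k ∨ x = alt j i k) ∨
    ∃ y, (∀ a ∈ y, a = i ∨ a = j) ∧ y.length < x.length ∧ sw c y = sw c x := by
  induction x using List.reverseRecOn with
  | nil => intro _; exact Or.inl ⟨0, Nat.zero_le _, Or.inl rfl⟩
  | append_singleton x a ih =>
    intro hx
    have hx' : ∀ b ∈ x, b = i ∨ b = j := fun b hb => hx b (by simp [hb])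
    -- generic step
    have step : ∀ p q : ι, p ≠ q → (∀ b, (b = p ∨ b = q) ↔ (b = i ∨ b = j)) → a = p →
        mm c p q = mm c i j →
        (∃ k ≤ mm c i j, x = alt p q k ∨ x = alt q p k) →
        (∃ k ≤ mm c i j, x ++ [a] = alt p q k) ∨
        ∃ y, (∀ b ∈ y, b = i ∨ b = j) ∧ y.length < (x ++ [a]).length ∧
          sw c y = sw c (x ++ [a]) := by
      intro p q hpq hmem hap hm hk
      subst hap
      have cancel : ∀ k, k + 1 ≤ mm c i j → sw c x = sw c (alt a q (k + 1)) →
          x.length = k + 1 → ∃ y, (∀ b ∈ y, b = i ∨ b = j) ∧ y.length < (x ++ [a]).length ∧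
          sw c y = sw c (x ++ [a]) := by
        intro k hk hs hl
        refine ⟨alt q a k, fun b hb => (hmem b).1 (alt_mem q a k b hb).symm, ?_, ?_⟩
        · simp [alt_length, hl]
        · rw [sw_append, hs]
          simp only [alt, sw_append, sw_cons, sw_nil, mul_one]
          rw [mul_assoc, sg_sq H, mul_one]
      obtain ⟨k, hk, hk' | hk'⟩ := hk
      · cases k with
        | zero =>
          left
          obtain ⟨m, hm'⟩ := mm_pos c i j
          exact ⟨1, by omega, by simp [hk', alt]⟩
        | succ k =>
          right
          exact cancel k hk (by rw [hk']) (by rw [hk', alt_length])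
      · rcases Nat.lt_or_ge k (mm c i j) with hlt | hge
        · left; exact ⟨k + 1, hlt, by rw [hk']; rfl⟩
        · right
          have hkm : k = mm c i j := le_antisymm hk hge
          obtain ⟨m, hm'⟩ := mm_pos c i j
          refine cancel m hm'.ge ?_ (by rw [hk', alt_length]; omega)
          rw [hk', hkm, ← hm', ← hm, s_braid H hpq]
    rcases ih hx' with h | ⟨y, h1, h2, h3⟩
    · rcases hx a (by simp) with ha | ha
      · rcases step i j hij (fun b => Iff.rfl) ha rfl h with ⟨k, hk, hh⟩ | h'
        · exact Or.inl ⟨k, hk, Or.inl hh⟩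
        · exact Or.inr h'
      · rcases step j i hij.symm (fun b => or_comm) ha (mm_symm c j i)
          (by obtain ⟨k, hk, hh⟩ := h; exact ⟨k, hk, hh.symm⟩) with ⟨k, hk, hh⟩ | h'
        · exact Or.inl ⟨k, hk, Or.inr hh⟩
        · exact Or.inr h'
    · right
      refine ⟨y ++ [a], ?_, by simpa using h2, by rw [sw_append, h3, sw_append]⟩
      intro b hb
      simp at hb
      rcases hb with hb | rfl
      · exact h1 b hb
      · exact hx b (by simp)

theorem alt_pos (H : CH c d) {i j : ι} (hij : i ≠ j) (k : ℕ) (hk : k < mm c i j) :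
    ∃ p p' : ℤ, 0 ≤ p ∧ 0 ≤ p' ∧
      sw c (alt j i k) (Pi.single i 1) = p • Pi.single i 1 + p' • Pi.single j 1 := by
  have hj : ∀ p p' : ℤ, sg c j (p • Pi.single i 1 + p' • Pi.single j 1) =
      p • Pi.single i 1 + (- c j i * p - p') • Pi.single j 1 := by
    intro p p'
    rw [map_add, map_smul, map_smul, sg_self H, sg_other]
    ext a; simp; ring
  have hi : ∀ p p' : ℤ, sg c i (p • Pi.single i 1 + p' • Pi.single j 1) =
      (- c i j * p' - p) • Pi.single i 1 + p' • Pi.single j 1 := by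
    intro p p'
    rw [map_add, map_smul, map_smul, sg_self H, sg_other]
    ext a; simp; ring
  have e0 : (Pi.single i 1 : ι → ℤ) = (1 : ℤ) • Pi.single i 1 + (0 : ℤ) • Pi.single j 1 := by simp
  have hm := H.pair i j hij
  have h6 : k < 6 := lt_of_lt_of_le hk (by unfold mm; split_ifs <;> simp)
  suffices h : ∃ p p' : ℤ, 0 ≤ p ∧ 0 ≤ p' ∧
      sw c (alt j i k) ((1 : ℤ) • Pi.single i 1 + (0 : ℤ) • Pi.single j 1) =
        p • Pi.single i 1 + p' • Pi.single j 1 by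
    rw [← e0] at h; exact h
  clear e0
  interval_cases k <;>
  simp only [alt, sw_append, sw_cons, sw_nil, mul_one, one_mul, Module.End.mul_apply,
    Module.End.one_apply, List.nil_append, hi, hj] <;>
  (refine ⟨_, _, ?_, ?_, rfl⟩ <;>
    rcases hm with h | h | h | h | h | h <;> simp [mm, h] at hk ⊢)
end Cox

section Mats
variable {ι : Type} [Fintype ι] [DecidableEq ι] {c : ι → ι → ℤ} {d : ι → ℤ}

theorem no_short {i j : ι} {e x : List ι} (h : Rd c (e ++ x)) :
    ¬ ∃ y, (∀ a ∈ y, a = i ∨ a = j) ∧ y.length < x.length ∧ sw c y = sw c x := by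
  rintro ⟨y, -, hl, hs⟩
  have := h (e ++ y) (by simp [hs])
  simp at this
  omega

theorem alt_ne {i j : ι} (hij : i ≠ j) {x : List ι} {k : ℕ} (h : x ++ [i] = alt j i k) : False := by
  cases k with
  | zero => simp [alt] at h
  | succ k =>
    have := List.append_inj_right' h rfl
    simp at this
    exact hij this

theorem nonneg_comb {v w : ι → ℤ} {p p' : ℤ} (hp : 0 ≤ p) (hp' : 0 ≤ p') (hv : 0 ≤ v)
    (hw : 0 ≤ w) : 0 ≤ p • v + p' • w := by
  intro k
  have h1 := mul_nonneg hp (hv k)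
  have h2 := mul_nonneg hp' (hw k)
  simp at h1 h2 ⊢
  linarith

theorem single_nonneg (i : ι) : (0 : ι → ℤ) ≤ Pi.single i 1 := by
  intro k
  by_cases h : k = i
  · subst h; simp
  · simp [Pi.single_apply, h]

theorem kp (H : CH c d) (n : ℕ) : ∀ (a : List ι) (i : ι), a.length = n → Rd c (a ++ [i]) →
    0 ≤ sw c a (Pi.single i 1) := by
  induction n using Nat.strong_induction_on with
  | _ n ih =>
    intro a i hn hr
    rcases List.eq_nil_or_concat a with rfl | ⟨a', j, rfl⟩
    · simpa using single_nonneg i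
    · rw [List.concat_eq_append] at *
      have hji : i ≠ j := by
        rintro rfl
        have := hr a' (by simp only [sw_append, sw_cons, sw_nil, mul_one]; rw [mul_assoc, sg_sq H, mul_one])
        simp at this
      obtain ⟨e, x, he, hx, hs, hl, hei, hej⟩ := decomp H i j _ a' [j] rfl (by simp) hr.left
      have hen : e.length < n := by simp at hn; omega
      have hi := ih _ hen e i rfl hei
      have hj := ih _ hen e j rfl hej
      have hr' : Rd c (e ++ (x ++ [i])) := by
        refine hr.congr ?_ ?_
        · rw [← List.append_assoc, sw_append, hs, ← sw_append]
        · simp at hl ⊢; omega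
      have hxi : ∀ b ∈ x ++ [i], b = i ∨ b = j := by
        intro b hb; simp at hb
        rcases hb with hb | hb
        · exact hx b hb
        · exact Or.inl hb
      rcases alt_or_short H hji (x ++ [i]) hxi with ⟨k, hk, h | h⟩ | h
      · cases k with
        | zero => simp [alt] at h
        | succ k =>
          have hx' : x = alt j i k := List.append_inj_left' h rfl
          obtain ⟨p, p', hp, hp', hpp⟩ := alt_pos H hji k hk
          rw [← hs, sw_append, Module.End.mul_apply, hx', hpp, map_add, map_smul, map_smul]
          exact nonneg_comb hp hp' hi hj
      · exact (alt_ne hji h).elim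
      · exact (no_short hr' h).elim

theorem sw_single_ne (H : CH c d) (a : List ι) (i : ι) : sw c a (Pi.single i 1) ≠ 0 := by
  intro h
  have := s_inj H a (v := Pi.single i 1) (w := 0) (by rw [h, map_zero])
  have := congrFun this i
  simp at this

theorem neg_last (H : CH c d) (a : List ι) (i : ι) :
    sw c (a ++ [i]) (Pi.single i 1) = - sw c a (Pi.single i 1) := by
  rw [sw_snoc, Module.End.mul_apply, sg_self H, map_neg]

theorem root_sign (H : CH c d) (a : List ι) (i : ι) :
    0 ≤ sw c a (Pi.single i 1) ∨ sw c a (Pi.single i 1) ≤ 0 := by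
  obtain ⟨b, hb, hs⟩ := exists_rd c a
  rw [← hs]
  by_cases h : Rd c (b ++ [i])
  · exact Or.inl (kp H _ b i rfl h)
  · right
    obtain ⟨e, he, hl⟩ := drop_last H hb h
    have hr : Rd c (e ++ [i]) := hb.congr he (by simpa using hl)
    rw [← he, neg_last H]
    have := kp H _ e i rfl hr
    simpa using this

theorem not_rd_neg (H : CH c d) {a : List ι} {i : ι} (h : ¬ 0 ≤ sw c a (Pi.single i 1)) :
    ¬ Rd c (a ++ [i]) := fun hr => h (kp H _ a i rfl hr)

theorem matsumoto {R : Type} [CommRing R] (A : ι → ι → R) (u : ι → R) (H : CH c d)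
    (hb : ∀ i j, i ≠ j → gw A u (alt i j (mm c i j)) = gw A u (alt j i (mm c i j))) (n : ℕ) :
    ∀ a b : List ι, a.length = n → b.length = n → Rd c a → sw c a = sw c b →
      gw A u a = gw A u b := by
  induction n with
  | zero =>
    intro a b ha hb _ _
    rw [List.length_eq_zero_iff] at ha hb
    rw [ha, hb]
  | succ n ih =>
    intro a b ha hb' hr hs
    have same : ∀ (a' b' : List ι) (i : ι), a'.length = n → b'.length = n → Rd c (a' ++ [i]) →
        sw c (a' ++ [i]) = sw c (b' ++ [i]) → gw A u (a' ++ [i]) = gw A u (b' ++ [i]) := by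
      intro a' b' i ha' hb' hr hs
      have : sw c a' = sw c b' := by
        have := congrArg (· * sg c i) hs
        simpa [mul_assoc, sg_sq H] using this
      rw [gw_append, gw_append, ih a' b' ha' hb' hr.left this]
    rcases List.eq_nil_or_concat a with rfl | ⟨a', i, rfl⟩
    · simp at ha
    rcases List.eq_nil_or_concat b with rfl | ⟨b', j, rfl⟩
    · simp at hb'
    rw [List.concat_eq_append] at *
    rw [List.concat_eq_append] at *
    simp only [List.length_append, List.length_singleton, Nat.add_right_cancel_iff] at ha hb'
    have hrb : Rd c (b' ++ [j]) := hr.congr hs.symm (by simp [ha, hb'])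
    by_cases hij : i = j
    · subst hij; exact same a' b' i ha hb' hr hs
    obtain ⟨e, x, he, hx, hs', hl, hei, hej⟩ := decomp H i j _ a' [i] rfl (by simp) hr
    have hi := kp H _ e i rfl hei
    have hj := kp H _ e j rfl hej
    have hr' : Rd c (e ++ x) := hr.congr hs' (by simpa using hl)
    have nni : ¬ 0 ≤ sw c (a' ++ [i]) (Pi.single i 1) := by
      intro h
      rw [neg_last H] at h
      have h2 := kp H _ a' i rfl hr
      exact sw_single_ne H a' i (le_antisymm (by simpa using h) h2)
    have nnj : ¬ 0 ≤ sw c (a' ++ [i]) (Pi.single j 1) := by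
      intro h
      rw [hs, neg_last H] at h
      have h2 := kp H _ b' j rfl hrb
      exact sw_single_ne H b' j (le_antisymm (by simpa using h) h2)
    have hxm : x = alt i j (mm c i j) ∨ x = alt j i (mm c i j) := by
      rcases alt_or_short H hij x hx with ⟨k, hk, h | h⟩ | h
      · rcases hk.lt_or_eq with hk | rfl
        · exfalso
          rw [mm_symm] at hk
          obtain ⟨p, p', hp, hp', hpp⟩ := alt_pos H (Ne.symm hij) k hk
          apply nnj
          rw [← hs', sw_append, Module.End.mul_apply, h, hpp, map_add, map_smul, map_smul]
          exact nonneg_comb hp hp' hj hi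
        · exact Or.inl h
      · rcases hk.lt_or_eq with hk | rfl
        · exfalso
          obtain ⟨p, p', hp, hp', hpp⟩ := alt_pos H hij k hk
          apply nni
          rw [← hs', sw_append, Module.End.mul_apply, h, hpp, map_add, map_smul, map_smul]
          exact nonneg_comb hp hp' hi hj
        · exact Or.inr h
      · exact (no_short hr' h).elim
    have hsb := s_braid H hij
    have hxs : sw c x = sw c (alt i j (mm c i j)) ∧ x.length = mm c i j := by
      rcases hxm with h | h
      · exact ⟨by rw [h], by rw [h, alt_length]⟩
      · exact ⟨by rw [h, hsb], by rw [h, alt_length]⟩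
    obtain ⟨m, hm⟩ := mm_pos c i j
    have s1 : sw c (a' ++ [i]) = sw c (e ++ alt i j (mm c i j)) := by
      rw [← hs', sw_append, hxs.1, ← sw_append]
    have s2 : sw c (b' ++ [j]) = sw c (e ++ alt j i (mm c i j)) := by
      rw [← hs, s1, sw_append, sw_append, hsb]
    have hlen : e.length + m = n := by
      have := hxs.2
      simp at hl; omega
    have t1 : gw A u (a' ++ [i]) = gw A u (e ++ alt i j (mm c i j)) := by
      have e1 : e ++ alt i j (mm c i j) = (e ++ alt j i m) ++ [i] := by
        rw [hm, List.append_assoc]; rfl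
      rw [e1] at s1 ⊢
      exact same _ _ i ha (by simp [alt_length, hlen]) hr s1
    have t2 : gw A u (b' ++ [j]) = gw A u (e ++ alt j i (mm c i j)) := by
      have e1 : e ++ alt j i (mm c i j) = (e ++ alt i j m) ++ [j] := by
        rw [hm, List.append_assoc]; rfl
      rw [e1] at s2 ⊢
      exact same _ _ j hb' (by simp [alt_length, hlen]) hrb s2
    rw [t1, t2, gw_append, gw_append, hb i j hij]

end Mats

section Roots
variable {ι : Type} [Fintype ι] [DecidableEq ι]

/-- Symmetrized form. -/
def bf (c : ι → ι → ℤ) (d : ι → ℤ) (v w : ι → ℤ) : ℤ := ∑ i, v i * (d i * rowL c i w)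

variable {c : ι → ι → ℤ} {d : ι → ℤ}

theorem bf_single (i : ι) (w : ι → ℤ) : bf c d (Pi.single i 1) w = d i * rowL c i w := by
  simp [bf, Pi.single_apply]

theorem bf_comm (H : CH c d) (v w : ι → ℤ) : bf c d v w = bf c d w v := by
  simp only [bf, rowL_apply, Finset.mul_sum]
  rw [Finset.sum_comm]
  refine Finset.sum_congr rfl fun i _ => Finset.sum_congr rfl fun j _ => ?_
  linear_combination v j * w i * H.symm j i

theorem bf_sub_smul (v w z : ι → ℤ) (k : ℤ) :
    bf c d v (w - k • z) = bf c d v w - k * bf c d v z := by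
  simp only [bf, map_sub, map_smul, Finset.mul_sum, ← Finset.sum_sub_distrib]
  refine Finset.sum_congr rfl fun i _ => ?_
  simp; ring

theorem bf_expand (H : CH c d) (v w : ι → ℤ) :
    bf c d v w = ∑ i, w i * bf c d v (Pi.single i 1) := by
  rw [bf_comm H, bf]
  refine Finset.sum_congr rfl fun i _ => ?_
  rw [bf_comm H, bf_single]

theorem bf_inv (H : CH c d) (i : ι) (v w : ι → ℤ) :
    bf c d (sg c i v) (sg c i w) = bf c d v w := by
  have h1 : ∀ z, bf c d z (Pi.single i 1) = d i * rowL c i z := fun z => by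
    rw [bf_comm H, bf_single]
  rw [sg_apply c i w, bf_sub_smul, bf_comm H _ w, sg_apply, bf_sub_smul, h1, h1, bf_comm H w v,
    map_sub, map_smul, rowL_single, H.diag]
  simp; ring

theorem bf_inv' (H : CH c d) (i : ι) (v w : ι → ℤ) :
    bf c d v (sg c i w) = bf c d (sg c i v) w := by
  rw [← bf_inv H i v, ← Module.End.mul_apply, sg_sq H]; rfl

theorem bf_inv_w (H : CH c d) (a : List ι) (v w : ι → ℤ) :
    bf c d (sw c a v) (sw c a w) = bf c d v w := by
  induction a with
  | nil => rfl
  | cons i a ih => rw [sw_cons, Module.End.mul_apply, Module.End.mul_apply, bf_inv H, ih]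

theorem bf_self_single (H : CH c d) (i : ι) :
    bf c d (Pi.single i 1) (Pi.single i 1) = 2 * d i := by
  rw [bf_single, rowL_single, H.diag, mul_comm]

/-- Roots. -/
def IsRt (c : ι → ι → ℤ) (β : ι → ℤ) : Prop := ∃ a i, β = sw c a (Pi.single i 1)

theorem rt_single (i : ι) : IsRt c (Pi.single i 1) := ⟨[], i, rfl⟩

theorem rt_sg {β : ι → ℤ} (h : IsRt c β) (i : ι) : IsRt c (sg c i β) := by
  obtain ⟨a, j, rfl⟩ := h
  exact ⟨i :: a, j, by simp⟩

theorem rt_neg (H : CH c d) {β : ι → ℤ} (h : IsRt c β) : IsRt c (-β) := by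
  obtain ⟨a, j, rfl⟩ := h
  exact ⟨a ++ [j], j, by rw [neg_last H]⟩

theorem rt_sign (H : CH c d) {β : ι → ℤ} (h : IsRt c β) : 0 ≤ β ∨ β ≤ 0 := by
  obtain ⟨a, j, rfl⟩ := h
  exact root_sign H a j

theorem rt_ne (H : CH c d) {β : ι → ℤ} (h : IsRt c β) : β ≠ 0 := by
  obtain ⟨a, j, rfl⟩ := h
  exact sw_single_ne H a j

theorem sg_sg (H : CH c d) (i : ι) (v : ι → ℤ) : sg c i (sg c i v) = v := by
  rw [← Module.End.mul_apply, sg_sq H]; rfl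

theorem sg_coord (i k : ι) (v : ι → ℤ) :
    sg c i v k = v k - if k = i then rowL c i v else 0 := by
  simp [sg_apply, Pi.single_apply]

theorem pos_simple (H : CH c d) {β : ι → ℤ} (h : IsRt c β) (hp : 0 ≤ β) {i : ι}
    (hne : β ≠ Pi.single i 1) : 0 ≤ sg c i β := by
  rcases rt_sign H (rt_sg h i) with h1 | h1
  · exact h1
  exfalso
  have h0 : ∀ k, k ≠ i → β k = 0 := by
    intro k hk
    have := h1 k
    rw [sg_coord, if_neg hk] at this
    have h2 := hp k
    simp at this h2
    omega
  have hb : β = β i • Pi.single i 1 := by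
    ext k
    by_cases hk : k = i
    · subst hk; simp
    · simp [h0 k hk, Pi.single_apply, hk]
  obtain ⟨a, j, ha⟩ := h
  have : (Pi.single j 1 : ι → ℤ) = β i • sw c a.reverse (Pi.single i 1) := by
    rw [← map_smul, ← hb, ha, ← Module.End.mul_apply, s_inv H]; rfl
  have := congrFun this j
  simp at this
  have hu : IsUnit (β i) := IsUnit.of_mul_eq_one _ this.symm
  have h2 := hp i
  rcases Int.isUnit_iff.1 hu with h3 | h3
  · apply hne; rw [hb, h3, one_smul]
  · rw [h3] at h2; simp at h2

open Classical in
/-- positive roots -/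
def PP (Φ : Finset (ι → ℤ)) : Finset (ι → ℤ) := Φ.filter (fun β => 0 ≤ β)

variable {Φ : Finset (ι → ℤ)}

theorem mem_PP {β : ι → ℤ} : β ∈ PP Φ ↔ β ∈ Φ ∧ 0 ≤ β := by
  classical
  simp [PP]

theorem sum_Φ (H : CH c d) (hΦ : ∀ β, β ∈ Φ ↔ IsRt c β) (G : (ι → ℤ) → ℚ)
    (hG : ∀ β, G (-β) = G β) : ∑ β ∈ Φ, G β = 2 * ∑ β ∈ PP Φ, G β := by
  classical
  rw [← Finset.sum_filter_add_sum_filter_not Φ (fun β => 0 ≤ β)]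
  have : ∑ β ∈ Φ.filter (fun β => ¬ 0 ≤ β), G β = ∑ β ∈ PP Φ, G β := by
    refine Finset.sum_nbij' (fun β => -β) (fun β => -β) ?_ ?_ (by simp) (by simp) (by simp [hG])
    · intro β hβ
      rw [Finset.mem_filter, hΦ] at hβ
      rw [mem_PP, hΦ]
      refine ⟨rt_neg H hβ.1, ?_⟩
      have := (rt_sign H hβ.1).resolve_left hβ.2
      simpa using this
    · intro β hβ
      rw [mem_PP, hΦ] at hβ
      rw [Finset.mem_filter, hΦ]
      refine ⟨rt_neg H hβ.1, fun h => rt_ne H hβ.1 (le_antisymm (by simpa using h) hβ.2)⟩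
  rw [this, PP]
  have e : ∀ x : ℚ, x + x = 2 * x := fun x => by ring
  convert e _

theorem sum_sg (H : CH c d) (hΦ : ∀ β, β ∈ Φ ↔ IsRt c β) (G : (ι → ℤ) → ℚ) (i : ι) :
    ∑ β ∈ Φ, G (sg c i β) = ∑ β ∈ Φ, G β := by
  refine Finset.sum_nbij' (fun β => sg c i β) (fun β => sg c i β) ?_ ?_ ?_ ?_ (by simp)
  · intro β hβ; rw [hΦ] at *; exact rt_sg hβ i
  · intro β hβ; rw [hΦ] at *; exact rt_sg hβ i
  · intro β _; exact sg_sg H i β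
  · intro β _; exact sg_sg H i β

theorem PP_single (hΦ : ∀ β, β ∈ Φ ↔ IsRt c β) (i : ι) : Pi.single i 1 ∈ PP Φ := by
  rw [mem_PP, hΦ]; exact ⟨rt_single i, single_nonneg i⟩

theorem sum_PP_sg (H : CH c d) (hΦ : ∀ β, β ∈ Φ ↔ IsRt c β) (G : (ι → ℤ) → ℚ) (i : ι) :
    ∑ β ∈ (PP Φ).erase (Pi.single i 1), G (sg c i β) =
      ∑ β ∈ (PP Φ).erase (Pi.single i 1), G β := by
  have key : ∀ β ∈ (PP Φ).erase (Pi.single i 1), sg c i β ∈ (PP Φ).erase (Pi.single i 1) := by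
    intro β hβ
    rw [Finset.mem_erase, mem_PP, hΦ] at *
    refine ⟨?_, rt_sg hβ.2.1 i, pos_simple H hβ.2.1 hβ.2.2 hβ.1⟩
    intro h
    have h2 := congrArg (sg c i) h
    rw [sg_sg H, sg_self H] at h2
    have := hβ.2.2 i
    rw [h2] at this
    simp at this
  refine Finset.sum_nbij' (fun β => sg c i β) (fun β => sg c i β) key key ?_ ?_ (by simp)
  · intro β _; exact sg_sg H i β
  · intro β _; exact sg_sg H i β

open Classical in
theorem word_sum (H : CH c d) (hΦ : ∀ β, β ∈ Φ ↔ IsRt c β) (F : (ι → ℤ) → ℚ)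
    (hF : ∀ i β, F (sg c i β) = F β) (a : List ι) : Rd c a →
    ∑ β ∈ PP Φ, (if sw c a β ≤ 0 then F β else 0) = (a.map (fun i => F (Pi.single i 1))).sum := by
  induction a using List.reverseRecOn with
  | nil =>
    intro _
    simp only [List.map_nil, List.sum_nil]
    refine Finset.sum_eq_zero fun β hβ => ?_
    rw [mem_PP, hΦ] at hβ
    rw [if_neg]
    intro h
    exact rt_ne H hβ.1 (le_antisymm h hβ.2)
  | append_singleton a i ih =>
    intro hr
    have hp := kp H _ a i rfl hr
    have hne := sw_single_ne H a i
    rw [List.map_append, List.sum_append, ← ih hr.left,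
      ← Finset.add_sum_erase _ _ (PP_single hΦ i), ← Finset.add_sum_erase (PP Φ) _ (PP_single hΦ i),
      if_pos, if_neg, ← sum_PP_sg H hΦ (fun β => if sw c a β ≤ 0 then F β else 0) i]
    · simp only [sw_snoc, Module.End.mul_apply, hF]
      simp; ring
    · intro h; exact hne (le_antisymm h hp)
    · rw [neg_last H]; simpa using hp

/-- The Casimir-like operator. -/
def AA (c : ι → ι → ℤ) (d : ι → ℤ) (Φ : Finset (ι → ℤ)) (F : (ι → ℤ) → ℚ) (v : ι → ℤ) (k : ι) : ℚ :=
  ∑ β ∈ Φ, F β * (bf c d β v : ℚ) * (β k : ℚ)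

theorem AA_lin (F : (ι → ℤ) → ℚ) (v z : ι → ℤ) (m : ℤ) (k : ι) :
    AA c d Φ F (v - m • z) k = AA c d Φ F v k - m * AA c d Φ F z k := by
  simp only [AA, Finset.mul_sum, ← Finset.sum_sub_distrib, bf_sub_smul]
  refine Finset.sum_congr rfl fun β _ => ?_
  push_cast; ring

theorem AA_sg (H : CH c d) (hΦ : ∀ β, β ∈ Φ ↔ IsRt c β) (F : (ι → ℤ) → ℚ)
    (hF : ∀ i β, F (sg c i β) = F β) (v : ι → ℤ) (i k : ι) :
    AA c d Φ F (sg c i v) k =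
      AA c d Φ F v k - if k = i then ∑ j, (c i j : ℚ) * AA c d Φ F v j else 0 := by
  have : AA c d Φ F (sg c i v) k = ∑ β ∈ Φ, F β * (bf c d β v : ℚ) * ((sg c i β) k : ℚ) := by
    rw [AA, ← sum_sg H hΦ _ i]
    refine Finset.sum_congr rfl fun β _ => ?_
    rw [bf_inv H, hF]
  rw [this]
  by_cases hk : k = i
  · subst hk
    simp only [sg_coord, if_true, AA, Finset.mul_sum, rowL_apply]
    rw [Finset.sum_comm, ← Finset.sum_sub_distrib]
    refine Finset.sum_congr rfl fun β _ => ?_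
    push_cast
    rw [mul_sub, Finset.mul_sum]
    congr 1
    refine Finset.sum_congr rfl fun j _ => ?_
    ring
  · simp [sg_coord, hk, AA]

theorem AA_scalar [Nonempty ι] (H : CH c d) (hΦ : ∀ β, β ∈ Φ ↔ IsRt c β) (F : (ι → ℤ) → ℚ)
    (hF : ∀ i β, F (sg c i β) = F β)
    (hconn : ∀ i j : ι, Relation.ReflTransGen (fun a b => a ≠ b ∧ c a b ≠ 0) i j) :
    ∃ κ : ℚ, ∀ i k, AA c d Φ F (Pi.single i 1) k = if k = i then κ else 0 := by
  have h1 : ∀ v i k, (rowL c i v : ℚ) * AA c d Φ F (Pi.single i 1) k =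
      if k = i then ∑ j, (c i j : ℚ) * AA c d Φ F v j else 0 := by
    intro v i k
    have := AA_sg H hΦ F hF v i k
    rw [sg_apply, AA_lin] at this
    linarith
  have h2 : ∀ i k, k ≠ i → AA c d Φ F (Pi.single i 1) k = 0 := by
    intro i k hk
    have := h1 (Pi.single i 1) i k
    rw [rowL_single, H.diag, if_neg hk] at this
    push_cast at this
    linarith
  have h3 : ∀ i j, c i j ≠ 0 →
      AA c d Φ F (Pi.single i 1) i = AA c d Φ F (Pi.single j 1) j := by
    intro i j hc
    have := h1 (Pi.single j 1) i i
    rw [rowL_single, if_pos rfl, Finset.sum_eq_single j] at this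
    · exact mul_left_cancel₀ (Int.cast_ne_zero.2 hc) this
    · intro b _ hb; rw [h2 j b hb, mul_zero]
    · simp
  obtain ⟨i0⟩ := ‹Nonempty ι›
  have h4 : ∀ j, AA c d Φ F (Pi.single i0 1) i0 = AA c d Φ F (Pi.single j 1) j := by
    intro j
    induction hconn i0 j with
    | refl => rfl
    | tail _ h ih => rw [ih, h3 _ _ h.2]
  refine ⟨AA c d Φ F (Pi.single i0 1) i0, fun i k => ?_⟩
  by_cases hk : k = i
  · subst hk; rw [if_pos rfl, h4]
  · rw [if_neg hk, h2 _ _ hk]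

theorem AA_expand (H : CH c d) (F : (ι → ℤ) → ℚ) (v : ι → ℤ) (k : ι) :
    AA c d Φ F v k = ∑ i, (v i : ℚ) * AA c d Φ F (Pi.single i 1) k := by
  simp only [AA, Finset.mul_sum]
  rw [Finset.sum_comm]
  refine Finset.sum_congr rfl fun β _ => ?_
  rw [bf_expand H β v]
  push_cast
  rw [Finset.mul_sum, Finset.sum_mul]
  refine Finset.sum_congr rfl fun i _ => ?_
  ring

theorem AA_trace (H : CH c d) (F : (ι → ℤ) → ℚ) {κ : ℚ}
    (hκ : ∀ i k, AA c d Φ F (Pi.single i 1) k = if k = i then κ else 0) :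
    ∑ β ∈ Φ, F β * (bf c d β β : ℚ) = Fintype.card ι * κ := by
  have : ∑ i, AA c d Φ F (Pi.single i 1) i = Fintype.card ι * κ := by
    simp [hκ]
  rw [← this]
  simp only [AA]
  rw [Finset.sum_comm]
  refine Finset.sum_congr rfl fun β _ => ?_
  rw [bf_expand H β β]
  push_cast
  rw [Finset.mul_sum]
  refine Finset.sum_congr rfl fun i _ => ?_
  ring

theorem AA_form (H : CH c d) (F : (ι → ℤ) → ℚ) {κ : ℚ}
    (hκ : ∀ i k, AA c d Φ F (Pi.single i 1) k = if k = i then κ else 0) (v : ι → ℤ) :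
    ∑ β ∈ Φ, F β * (bf c d β v : ℚ) ^ 2 = κ * (bf c d v v : ℚ) := by
  have h1 : ∀ k, AA c d Φ F v k = κ * v k := by
    intro k; rw [AA_expand H]; simp [hκ, mul_comm]
  have h2 : ∑ k, AA c d Φ F v k * (bf c d v (Pi.single k 1) : ℚ) = κ * (bf c d v v : ℚ) := by
    rw [bf_expand H v v]
    push_cast
    rw [Finset.mul_sum]
    refine Finset.sum_congr rfl fun k _ => ?_
    rw [h1]; ring
  rw [← h2]
  simp only [AA, Finset.sum_mul]
  rw [Finset.sum_comm]
  refine Finset.sum_congr rfl fun β _ => ?_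
  rw [sq]
  nth_rewrite 2 [bf_comm H β v]
  rw [bf_expand H v β]
  push_cast
  rw [Finset.mul_sum]
  rw [Finset.mul_sum]
  refine Finset.sum_congr rfl fun k _ => ?_
  ring

end Roots

section Count
variable {ι : Type} [Fintype ι] [DecidableEq ι]

theorem bf_sub_left {c : ι → ι → ℤ} {d : ι → ℤ} (v w z : ι → ℤ) :
    bf c d (v - w) z = bf c d v z - bf c d w z := by
  simp only [bf, ← Finset.sum_sub_distrib]
  refine Finset.sum_congr rfl fun i _ => ?_
  simp; ring

/-- Data for the counting argument. -/
structure CD (c : ι → ι → ℤ) (d : ι → ℤ) (r : ℤ) (Φ : Finset (ι → ℤ)) (θ : ι → ℤ)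
    (ww : List ι) (st : ι → ι) : Prop where
  H : CH c d
  hΦ : ∀ β, β ∈ Φ ↔ IsRt c β
  hconn : ∀ i j : ι, Relation.ReflTransGen (fun a b => a ≠ b ∧ c a b ≠ 0) i j
  hrmax : ∀ i, d i ≤ r
  hrmem : ∃ i, d i = r
  hθ : θ ∈ Φ
  hmax : ∀ β ∈ Φ, β ≤ θ
  hst : ∀ i, sw c ww (Pi.single i 1) = - Pi.single (st i) 1

variable {c : ι → ι → ℤ} {d : ι → ℤ} {r : ℤ} {Φ : Finset (ι → ℤ)} {θ : ι → ℤ}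
    {ww : List ι} {st : ι → ι}

theorem CD.rpos (D : CD c d r Φ θ ww st) : 0 < r := by
  obtain ⟨i, hi⟩ := D.hrmem
  rw [← hi]; exact D.H.dpos i

theorem CD.dom (D : CD c d r Φ θ ww st) (i : ι) : 0 ≤ rowL c i θ := by
  have h := D.hmax (sg c i θ) ((D.hΦ _).2 (rt_sg ((D.hΦ _).1 D.hθ) i)) i
  rw [sg_coord, if_pos rfl] at h
  linarith

theorem bf_nonneg {v w : ι → ℤ} (hd : ∀ i, 0 < d i) (hv : 0 ≤ v) (hw : ∀ i, 0 ≤ rowL c i w) :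
    0 ≤ bf c d v w :=
  Finset.sum_nonneg fun i _ => mul_nonneg (hv i) (mul_nonneg (hd i).le (hw i))

theorem CD.norm (D : CD c d r Φ θ ww st) {β : ι → ℤ} (h : β ∈ Φ) : bf c d β β ≤ 2 * r := by
  obtain ⟨a, i, rfl⟩ := (D.hΦ _).1 h
  rw [bf_inv_w D.H, bf_self_single D.H]
  linarith [D.hrmax i]

theorem CD.normpos (D : CD c d r Φ θ ww st) {β : ι → ℤ} (h : β ∈ Φ) : 0 < bf c d β β := by
  obtain ⟨a, i, rfl⟩ := (D.hΦ _).1 h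
  rw [bf_inv_w D.H, bf_self_single D.H]
  linarith [D.H.dpos i]

theorem CD.long (D : CD c d r Φ θ ww st) : bf c d θ θ = 2 * r := by
  refine le_antisymm (D.norm D.hθ) ?_
  obtain ⟨i, hi⟩ := D.hrmem
  obtain ⟨β, hβ, hm⟩ := Finset.exists_max_image (Φ.filter (fun β => bf c d β β = 2 * r))
    (fun β => ∑ k, β k) ⟨Pi.single i 1, by
      rw [Finset.mem_filter]
      exact ⟨(D.hΦ _).2 (rt_single i), by rw [bf_self_single D.H, hi]⟩⟩
  rw [Finset.mem_filter] at hβ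
  have hdom : ∀ j, 0 ≤ rowL c j β := by
    intro j
    have := hm (sg c j β) (by
      rw [Finset.mem_filter]
      exact ⟨(D.hΦ _).2 (rt_sg ((D.hΦ _).1 hβ.1) j), by rw [bf_inv D.H, hβ.2]⟩)
    simp only [sg_coord, Finset.sum_sub_distrib] at this
    simp at this
    exact this
  have hle : 0 ≤ θ - β := sub_nonneg.2 (D.hmax β hβ.1)
  have h1 := bf_nonneg (d := d) D.H.dpos hle D.dom
  have h2 := bf_nonneg (d := d) D.H.dpos hle hdom
  rw [bf_sub_left] at h1 h2
  have := bf_comm D.H θ β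
  linarith [hβ.2]

theorem CD.psd [Nonempty ι] (D : CD c d r Φ θ ww st) {v : ι → ℤ} (h : bf c d v v ≤ 0) (i : ι) :
    rowL c i v = 0 := by
  obtain ⟨κ, hκ⟩ := AA_scalar D.H D.hΦ (fun _ => 1) (fun _ _ => rfl) D.hconn
  have hform := AA_form D.H _ hκ
  have hi : Pi.single i 1 ∈ Φ := (D.hΦ _).2 (rt_single i)
  have hd := D.H.dpos i
  have hκ0 : 0 < κ := by
    have h1 := hform (Pi.single i 1)
    have h2 : (0 : ℚ) < ∑ β ∈ Φ, 1 * (bf c d β (Pi.single i 1) : ℚ) ^ 2 := by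
      refine Finset.sum_pos' (fun β _ => by positivity) ⟨_, hi, ?_⟩
      rw [bf_self_single D.H]; positivity
    rw [h1, bf_self_single D.H] at h2
    have h3 : (0 : ℚ) < ((2 * d i : ℤ) : ℚ) := by exact_mod_cast (by linarith)
    exact (pos_iff_pos_of_mul_pos h2).2 h3
  have h1 := hform v
  have h2 : κ * (bf c d v v : ℚ) ≤ 0 :=
    mul_nonpos_of_nonneg_of_nonpos hκ0.le (by exact_mod_cast h)
  rw [← h1] at h2
  have h3 := (Finset.sum_eq_zero_iff_of_nonneg (s := Φ)
    (f := fun β => 1 * (bf c d β v : ℚ) ^ 2) (fun β _ => by positivity)).1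
    (le_antisymm h2 (Finset.sum_nonneg fun β _ => by positivity)) _ hi
  have h4 : bf c d (Pi.single i 1) v = 0 := by simpa using h3
  rw [bf_single] at h4
  exact (mul_eq_zero.1 h4).resolve_left hd.ne'

theorem D_aux (hst : ∀ i, sw c ww (Pi.single i 1) = - Pi.single (st i) 1) {v : ι → ℤ}
    (hv : 0 ≤ v) : sw c ww v ≤ 0 := by
  have e : v = ∑ k, v k • (Pi.single k 1 : ι → ℤ) := by
    ext j; simp [Finset.sum_apply, Pi.single_apply]
  rw [e, map_sum]
  refine Finset.sum_nonpos fun k _ => ?_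
  rw [map_smul, hst]
  intro j
  have h1 := mul_nonneg (hv k) (single_nonneg (st k) j)
  simp at h1 ⊢
  exact h1

theorem CD.gap [Nonempty ι] (D : CD c d r Φ θ ww st) {β : ι → ℤ} (h : β ∈ PP Φ) (hne : β ≠ θ) :
    bf c d β θ = 0 ∨ bf c d β θ = r := by
  rw [mem_PP] at h
  have hr := D.rpos
  have h0 := bf_nonneg (d := d) D.H.dpos h.2 D.dom
  obtain ⟨a, j, ha⟩ := (D.hΦ _).1 D.hθ
  have hdj : d j = r := by
    have := D.long
    rw [ha, bf_inv_w D.H, bf_self_single D.H] at this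
    linarith
  have hm : ∃ m, bf c d β θ = r * m := by
    refine ⟨rowL c j (sw c a.reverse β), ?_⟩
    rw [bf_comm D.H, ← hdj, ← bf_single, ← bf_inv_w D.H a (Pi.single j 1), ← ha,
      ← Module.End.mul_apply, s_inv' D.H]; rfl
  obtain ⟨m, hm⟩ := hm
  rcases lt_or_ge m 2 with h2 | h2
  · have : 0 ≤ m := by
      by_contra hneg
      push Not at hneg
      nlinarith
    interval_cases m
    · left; rw [hm]; ring
    · right; rw [hm]; ring
  · exfalso
    have hn : bf c d (θ - β) (θ - β) ≤ 0 := by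
      have e : bf c d (θ - β) (θ - β) = bf c d θ θ - 2 * bf c d β θ + bf c d β β := by
        have := bf_sub_smul (c := c) (d := d) (θ - β) θ β 1
        rw [one_smul] at this
        rw [this, bf_sub_left, bf_sub_left, bf_comm D.H θ β]; ring
      have := D.norm h.1
      have := D.long
      rw [e]
      nlinarith
    have hrow := D.psd hn
    have hfix : ∀ l, sw c l (θ - β) = θ - β := by
      intro l
      induction l with
      | nil => rfl
      | cons i l ih => rw [sw_cons, Module.End.mul_apply, ih, sg_apply, hrow, zero_smul, sub_zero]
    have hge : 0 ≤ θ - β := sub_nonneg.2 (D.hmax β h.1)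
    have hle : θ - β ≤ 0 := by
      rw [← hfix ww]
      exact D_aux D.hst hge
    exact hne (sub_eq_zero.1 (le_antisymm hle hge)).symm

theorem CD.count [Nonempty ι] (D : CD c d r Φ θ ww st) (F : (ι → ℤ) → ℚ)
    (hF : ∀ i β, F (sg c i β) = F β) (hF' : ∀ β, F (-β) = F β) :
    ∑ β ∈ PP Φ, F β * (bf c d β β : ℚ) =
      Fintype.card ι * (∑ i, (θ i : ℚ) * d i * F (Pi.single i 1) + r * F θ) := by
  have hr : (0 : ℚ) < r := by exact_mod_cast D.rpos
  obtain ⟨κ, hκ⟩ := AA_scalar D.H D.hΦ F hF D.hconn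
  have hneg : ∀ β w, bf c d (-β) w = - bf c d β w := by
    intro β w; simp [bf]
  have hneg' : ∀ β w, bf c d β (-w) = - bf c d β w := by
    intro β w; simp [bf]
  have h1 := AA_trace D.H F hκ
  rw [sum_Φ D.H D.hΦ _ (by intro β; simp [hF', hneg, hneg'])] at h1
  have h2 := AA_form D.H F hκ θ
  rw [sum_Φ D.H D.hΦ _ (by intro β; simp [hF', hneg]), D.long] at h2
  have hθP : θ ∈ PP Φ := by
    rw [mem_PP]
    refine ⟨D.hθ, fun k => ?_⟩
    have := D.hmax _ ((D.hΦ _).2 (rt_single k)) k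
    simp at this ⊢; omega
  have h3 : ∑ β ∈ PP Φ, F β * (bf c d β θ : ℚ) ^ 2 =
      r * ∑ β ∈ PP Φ, F β * (bf c d β θ : ℚ) + 2 * r ^ 2 * F θ := by
    rw [← Finset.add_sum_erase _ _ hθP, ← Finset.add_sum_erase (PP Φ) _ hθP, D.long, mul_add,
      Finset.mul_sum]
    have : ∑ β ∈ (PP Φ).erase θ, F β * (bf c d β θ : ℚ) ^ 2 =
        ∑ β ∈ (PP Φ).erase θ, r * (F β * (bf c d β θ : ℚ)) := by
      refine Finset.sum_congr rfl fun β hβ => ?_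
      rw [Finset.mem_erase] at hβ
      rcases D.gap hβ.2 hβ.1 with h | h <;> rw [h] <;> push_cast <;> ring
    rw [this]
    push_cast; ring
  have h4 : ∀ i, ∑ β ∈ PP Φ, F β * (rowL c i β : ℚ) = 2 * F (Pi.single i 1) := by
    intro i
    rw [← Finset.add_sum_erase _ _ (PP_single D.hΦ i), rowL_single, D.H.diag]
    have := sum_PP_sg D.H D.hΦ (fun β => F β * (rowL c i β : ℚ)) i
    simp only [hF, sg_row, D.H.diag] at this
    have e : ∑ β ∈ (PP Φ).erase (Pi.single i 1), F β * ((rowL c i β - 2 * rowL c i β : ℤ) : ℚ) =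
        - ∑ β ∈ (PP Φ).erase (Pi.single i 1), F β * (rowL c i β : ℚ) := by
      rw [← Finset.sum_neg_distrib]
      refine Finset.sum_congr rfl fun β _ => ?_
      push_cast; ring
    rw [e] at this
    have : ∑ β ∈ (PP Φ).erase (Pi.single i 1), F β * (rowL c i β : ℚ) = 0 := by linarith
    rw [this]; push_cast; ring
  have h5 : ∑ β ∈ PP Φ, F β * (bf c d β θ : ℚ) = 2 * ∑ i, (θ i : ℚ) * d i * F (Pi.single i 1) := by
    have : ∀ β ∈ PP Φ, F β * (bf c d β θ : ℚ) =
        ∑ i, (θ i : ℚ) * d i * (F β * (rowL c i β : ℚ)) := by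
      intro β _
      rw [bf_comm D.H, bf]
      push_cast
      rw [Finset.mul_sum]
      refine Finset.sum_congr rfl fun i _ => ?_
      ring
    rw [Finset.sum_congr rfl this, Finset.sum_comm, Finset.mul_sum]
    refine Finset.sum_congr rfl fun i _ => ?_
    rw [← Finset.mul_sum, h4]; ring
  rw [h3, h5] at h2
  have h6 : κ = 2 * (∑ i, (θ i : ℚ) * d i * F (Pi.single i 1) + r * F θ) := by
    have : (2 * r : ℚ) * κ = (2 * r) * (2 * (∑ i, (θ i : ℚ) * d i * F (Pi.single i 1) + r * F θ)) := by
      push_cast at h2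
      linarith
    exact mul_left_cancel₀ (by positivity) this
  rw [h6] at h1
  linarith

theorem CD.flip (D : CD c d r Φ θ ww st) {β : ι → ℤ} (h : β ∈ PP Φ) : sw c ww β ≤ 0 :=
  D_aux D.hst (mem_PP.1 h).2

theorem CD.sums [Nonempty ι] (D : CD c d r Φ θ ww st) (hr : Rd c ww) :
    2 * (ww.map d).sum = Fintype.card ι * (r + ∑ i, θ i * d i) ∧
    2 * (ww.length : ℤ) = Fintype.card ι * (1 + ∑ i, θ i) := by
  have e1 : ∀ F : (ι → ℤ) → ℚ, (∀ i β, F (sg c i β) = F β) →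
      ∑ β ∈ PP Φ, F β = (ww.map (fun i => F (Pi.single i 1))).sum := by
    intro F hF
    rw [← word_sum D.H D.hΦ F hF ww hr]
    refine Finset.sum_congr rfl fun β hβ => ?_
    rw [if_pos (D.flip hβ)]
  have hrp : (r : ℚ) ≠ 0 := by exact_mod_cast D.rpos.ne'
  have hneg : ∀ β, bf c d (-β) (-β) = bf c d β β := by
    intro β; simp [bf]
  constructor
  · have h1 := D.count (fun _ => 1) (fun _ _ => rfl) (fun _ => rfl)
    have h2 := e1 (fun β => (bf c d β β : ℚ)) (by intro i β; simp only [bf_inv D.H])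
    simp only [one_mul] at h1
    rw [h1] at h2
    have h3 : (ww.map (fun i => ((bf c d (Pi.single i 1) (Pi.single i 1) : ℤ) : ℚ))).sum =
        2 * (((ww.map d).sum : ℤ) : ℚ) := by
      have : ∀ l : List ι, (l.map (fun i => ((bf c d (Pi.single i 1) (Pi.single i 1) : ℤ) : ℚ))).sum =
          2 * (((l.map d).sum : ℤ) : ℚ) := by
        intro l
        induction l with
        | nil => simp
        | cons i l ih =>
          rw [List.map_cons, List.sum_cons, ih, bf_self_single D.H, List.map_cons, List.sum_cons,
            Int.cast_add, Int.cast_mul, mul_add]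
          norm_num
      exact this ww
    rw [h3] at h2
    have h4 : ((2 * (ww.map d).sum : ℤ) : ℚ) = ((Fintype.card ι * (r + ∑ i, θ i * d i) : ℤ) : ℚ) := by
      push_cast
      push_cast at h2
      rw [← h2]; simp; ring_nf
    exact_mod_cast h4
  · have h1 := D.count (fun β => 2 / (bf c d β β : ℚ)) (by intro i β; simp only [bf_inv D.H])
      (by intro β; simp only [hneg])
    have h2 := e1 (fun β => 2) (fun _ _ => rfl)
    have h3 : ∑ β ∈ PP Φ, 2 / (bf c d β β : ℚ) * (bf c d β β : ℚ) = ∑ β ∈ PP Φ, (2 : ℚ) := by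
      refine Finset.sum_congr rfl fun β hβ => ?_
      have : (bf c d β β : ℚ) ≠ 0 := by exact_mod_cast (D.normpos (mem_PP.1 hβ).1).ne'
      field_simp
    have h4 : ∑ i, (θ i : ℚ) * d i * (2 / (bf c d (Pi.single i 1) (Pi.single i 1) : ℚ)) =
        ∑ i, (θ i : ℚ) := by
      refine Finset.sum_congr rfl fun i _ => ?_
      have : (d i : ℚ) ≠ 0 := by exact_mod_cast (D.H.dpos i).ne'
      rw [bf_self_single D.H]
      push_cast
      field_simp
    rw [h3, h2, h4, D.long] at h1
    have h5 : ((2 * ww.length : ℤ) : ℚ) = ((Fintype.card ι * (1 + ∑ i, θ i) : ℤ) : ℚ) := by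
      push_cast
      push_cast at h1
      have e : (r : ℚ) * (2 / (2 * r)) = 1 := by field_simp
      rw [e] at h1
      simp at h1
      linarith
    exact_mod_cast h5

end Count

section Spec

/-- Evaluation of polynomials at `q = t = 1`. -/
def ev1 : MvPolynomial (Fin 2) ℚ →+* ℚ := MvPolynomial.eval (fun _ => 1)

/-- `f` is regular at `q = t = 1` with value `x`. -/
def SpR (f : KK) (x : ℚ) : Prop :=
  ∃ p s : MvPolynomial (Fin 2) ℚ, ev1 s ≠ 0 ∧
    f * algebraMap (MvPolynomial (Fin 2) ℚ) KK s = algebraMap (MvPolynomial (Fin 2) ℚ) KK p ∧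
    ev1 p = x * ev1 s

theorem am_ne {s : MvPolynomial (Fin 2) ℚ} (h : ev1 s ≠ 0) :
    algebraMap (MvPolynomial (Fin 2) ℚ) KK s ≠ 0 := by
  intro h0
  have : s = 0 := (IsFractionRing.injective (MvPolynomial (Fin 2) ℚ) KK) (by rw [h0, map_zero])
  exact h (by rw [this, map_zero])

theorem SpR.add {f g : KK} {x y : ℚ} (hf : SpR f x) (hg : SpR g y) : SpR (f + g) (x + y) := by
  obtain ⟨p, s, h1, h2, h3⟩ := hf
  obtain ⟨p', s', h1', h2', h3'⟩ := hg
  refine ⟨p * s' + p' * s, s * s', by simp [h1, h1'], ?_, ?_⟩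
  · simp only [map_mul, map_add, ← h2, ← h2']; ring
  · simp only [map_mul, map_add, h3, h3']; ring

theorem SpR.mul {f g : KK} {x y : ℚ} (hf : SpR f x) (hg : SpR g y) : SpR (f * g) (x * y) := by
  obtain ⟨p, s, h1, h2, h3⟩ := hf
  obtain ⟨p', s', h1', h2', h3'⟩ := hg
  refine ⟨p * p', s * s', by simp [h1, h1'], ?_, ?_⟩
  · simp only [map_mul, ← h2, ← h2']; ring
  · simp only [map_mul, h3, h3']; ring

theorem SpR.neg {f : KK} {x : ℚ} (hf : SpR f x) : SpR (-f) (-x) := by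
  obtain ⟨p, s, h1, h2, h3⟩ := hf
  refine ⟨-p, s, h1, ?_, ?_⟩
  · simp only [map_neg, ← h2]; ring
  · simp only [map_neg, h3]; ring

theorem SpR.sub {f g : KK} {x y : ℚ} (hf : SpR f x) (hg : SpR g y) : SpR (f - g) (x - y) := by
  rw [sub_eq_add_neg, sub_eq_add_neg]; exact hf.add hg.neg

theorem rel_zero : SpR 0 0 := ⟨0, 1, by simp, by simp, by simp⟩
theorem rel_one : SpR 1 1 := ⟨1, 1, by simp, by simp, by simp⟩

theorem SpR.ne {f : KK} {x : ℚ} (hf : SpR f x) (hx : x ≠ 0) : f ≠ 0 := by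
  obtain ⟨p, s, h1, h2, h3⟩ := hf
  rintro rfl
  have hp : ev1 p ≠ 0 := by rw [h3]; exact mul_ne_zero hx h1
  exact am_ne hp (by rw [← h2, zero_mul])

theorem SpR.inv {f : KK} {x : ℚ} (hf : SpR f x) (hx : x ≠ 0) : SpR f⁻¹ x⁻¹ := by
  have hf0 := hf.ne hx
  obtain ⟨p, s, h1, h2, h3⟩ := hf
  refine ⟨s, p, by rw [h3]; exact mul_ne_zero hx h1, ?_, ?_⟩
  · rw [← h2]; field_simp
  · rw [h3]; field_simp

theorem SpR.uniq {f : KK} {x y : ℚ} (hf : SpR f x) (hg : SpR f y) : x = y := by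
  by_contra h
  exact (hf.sub hg).ne (sub_ne_zero.2 h) (sub_self f)

theorem SpR.pow {f : KK} {x : ℚ} (hf : SpR f x) (n : ℕ) : SpR (f ^ n) (x ^ n) := by
  induction n with
  | zero => simpa using rel_one
  | succ n ih => rw [pow_succ, pow_succ]; exact ih.mul hf

theorem SpR.zpow1 {f : KK} (hf : SpR f 1) (n : ℤ) : SpR (f ^ n) 1 := by
  cases n with
  | ofNat n => simpa using hf.pow n
  | negSucc n =>
    rw [zpow_negSucc]
    simpa using (hf.pow (n+1)).inv (by simp)

theorem SpR.sum {α : Type} (s : Finset α) {f : α → KK} {x : α → ℚ} (h : ∀ a, SpR (f a) (x a)) :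
    SpR (∑ a ∈ s, f a) (∑ a ∈ s, x a) := by
  classical
  induction s using Finset.induction_on with
  | empty => simpa using rel_zero
  | insert a s ha ih => rw [Finset.sum_insert ha, Finset.sum_insert ha]; exact (h a).add ih

theorem rel_q : SpR qv 1 := ⟨MvPolynomial.X 0, 1, by simp, by simp [qv], by simp [ev1]⟩
theorem rel_t : SpR tv 1 := ⟨MvPolynomial.X 1, 1, by simp, by simp [tv], by simp [ev1]⟩

theorem qv_ne : qv ≠ 0 := rel_q.ne one_ne_zero
theorem tv_ne : tv ≠ 0 := rel_t.ne one_ne_zero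

theorem qq_ne : qv - qv⁻¹ ≠ 0 := by
  intro h
  have h1 : qv * qv = 1 := by
    have := qv_ne
    field_simp at h
    linear_combination h
  have h2 : (MvPolynomial.X 0 * MvPolynomial.X 0 : MvPolynomial (Fin 2) ℚ) = 1 := by
    apply IsFractionRing.injective (MvPolynomial (Fin 2) ℚ) KK
    rw [map_mul, map_one]; exact h1
  have h3 := congrArg (MvPolynomial.eval (fun _ => (2:ℚ))) h2
  norm_num at h3

theorem qint_neg (k : ℤ) : qint (-k) = - qint k := by
  simp only [qint, neg_neg]; ring

theorem qint_succ (k : ℤ) : qint (k + 1) = qv * qint k + qv ^ (-k) := by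
  have h := qq_ne
  have h0 := qv_ne
  simp only [qint]
  rw [← mul_div_assoc, div_add' _ _ _ h]
  congr 1
  rw [neg_add, zpow_add₀ h0, zpow_add₀ h0]
  simp only [zpow_one, zpow_neg_one]
  ring

theorem qint_zero : qint 0 = 0 := by simp [qint]
theorem qint_one : qint 1 = 1 := by rw [← zero_add (1:ℤ), qint_succ, qint_zero]; simp

theorem rel_qint (k : ℤ) : SpR (qint k) k := by
  have key : ∀ n : ℕ, SpR (qint n) (n : ℚ) := by
    intro n
    induction n with
    | zero => simpa [qint_zero] using rel_zero
    | succ n ih =>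
      push_cast
      rw [qint_succ]
      have := (rel_q.mul ih).add (rel_q.zpow1 (-(n:ℤ)))
      simpa using this
  obtain ⟨n, rfl | rfl⟩ := Int.eq_nat_or_neg k
  · simpa using key n
  · rw [qint_neg]; simpa using (key n).neg

theorem qint_ne {k : ℤ} (h : k ≠ 0) : qint k ≠ 0 := (rel_qint k).ne (by exact_mod_cast h)

theorem qint_m1 : qint (-1) = -1 := by rw [qint_neg, qint_one]
theorem qint_m2 : qint (-2) = -(qv + qv⁻¹) := by
  rw [qint_neg, show (2:ℤ) = 1 + 1 by norm_num, qint_succ, qint_one]; simp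
theorem qint_m3 : qint (-3) = -(qv ^ 2 + 1 + (qv⁻¹) ^ 2) := by
  rw [qint_neg, show (3:ℤ) = 1 + 1 + 1 by norm_num, qint_succ, qint_succ, qint_one]
  have := qv_ne
  norm_num
  field_simp
  ring
end Spec

section TT
variable {ι : Type} [Fintype ι] [DecidableEq ι] {c : ι → ι → ℤ} {d : ι → ℤ}

/-- The scalars `q^{-d_i} t`. -/
def uu (d : ι → ℤ) (i : ι) : KK := qv ^ (-(d i)) * tv

theorem uu_ne (d : ι → ℤ) (i : ι) : uu d i ≠ 0 := mul_ne_zero (zpow_ne_zero _ qv_ne) tv_ne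
theorem rel_uu (d : ι → ℤ) (i : ι) : SpR (uu d i) 1 := by
  have := (rel_q.zpow1 (-(d i))).mul rel_t
  rw [one_mul] at this
  exact this

theorem Cqt_diag (i : ι) : Cqt c d i i = (uu d i)⁻¹ + uu d i := by
  simp only [Cqt, if_true, uu, mul_inv, zpow_neg, inv_inv]

theorem Cqt_off {i j : ι} (h : i ≠ j) : Cqt c d i j = qint (c i j) := by simp [Cqt, h]

theorem rel_Cqt (H : CH c d) (i j : ι) : SpR (Cqt c d i j) (c i j) := by
  by_cases h : i = j
  · subst h
    rw [Cqt_diag, H.diag]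
    have := ((rel_uu d i).inv one_ne_zero).add (rel_uu d i)
    norm_num at this ⊢
    exact this
  · rw [Cqt_off h]; exact rel_qint _

theorem u_diag (i : ι) : uu d i * Cqt c d i i = 1 + uu d i ^ 2 := by
  rw [Cqt_diag]; have := uu_ne d i; field_simp

theorem T_braid (H : CH c d) {i j : ι} (hij : i ≠ j) :
    gw (Cqt c d) (uu d) (alt i j (mm c i j)) = gw (Cqt c d) (uu d) (alt j i (mm c i j)) := by
  have hq := qv_ne
  have hi := u_diag (c := c) (d := d) i
  have hj := u_diag (c := c) (d := d) j
  have e1 := Cqt_off (c := c) (d := d) hij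
  have e2 := Cqt_off (c := c) (d := d) hij.symm
  have z1 : qv ^ (-1:ℤ) = qv⁻¹ := by simp
  have z2 : qv ^ (-2:ℤ) = (qv⁻¹)^2 := by rw [zpow_neg]; norm_cast; simp
  have z3 : qv ^ (-3:ℤ) = (qv⁻¹)^3 := by rw [zpow_neg]; norm_cast; simp
  rcases H.pair i j hij with ⟨h1, h2⟩ | ⟨h0, h1, h2⟩ | ⟨h0, h0', h1, h2⟩ | ⟨h0, h0', h1, h2⟩ | ⟨h0, h0', h1, h2⟩ |
    ⟨h0, h0', h1, h2⟩ <;> rw [h1] at e1 <;> rw [h2] at e2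
  · rw [qint_zero] at e1 e2
    have : mm c i j = 2 := by simp [mm, h1]
    rw [this]; exact braid2 _ _ i j hij e1 e2
  · have : mm c i j = 3 := by simp [mm, h1, h2]
    rw [this]
    refine braid3 _ _ i j hij (by simp [uu, h0]) (by rw [e1, e2, qint_m1]; ring) hi hj
  · have : mm c i j = 4 := by simp [mm, h1, h2]
    rw [this]
    refine braid4 _ _ i j hij ?_ hi hj
    rw [e1, e2, qint_m1, qint_m2]; simp only [uu, h0, h0', z1, z2]; field_simp
  · have : mm c i j = 4 := by simp [mm, h1, h2]
    rw [this]
    refine braid4 _ _ i j hij ?_ hi hj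
    rw [e1, e2, qint_m1, qint_m2]; simp only [uu, h0, h0', z1, z2]; field_simp; ring
  · have : mm c i j = 6 := by simp [mm, h1, h2]
    rw [this]
    refine braid6 _ _ i j hij ?_ hi hj
    rw [e1, e2, qint_m1, qint_m3]; simp only [uu, h0, h0', z1, z3]; field_simp
  · have : mm c i j = 6 := by simp [mm, h1, h2]
    rw [this]
    refine braid6 _ _ i j hij ?_ hi hj
    rw [e1, e2, qint_m1, qint_m3]; simp only [uu, h0, h0', z1, z3]; field_simp; ring

theorem rel_tw (H : CH c d) (l : List ι) {v : ι → KK} {z : ι → ℤ} (h : ∀ k, SpR (v k) (z k)) :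
    ∀ k, SpR (gw (Cqt c d) (uu d) l v k) (sw c l z k) := by
  induction l with
  | nil => simpa using h
  | cons i l ih =>
    intro k
    rw [gw_cons, sw_cons, Module.End.mul_apply, Module.End.mul_apply, gr_apply_apply, sg_coord]
    have h1 : SpR (rowL (Cqt c d) i (gw (Cqt c d) (uu d) l v)) (rowL c i (sw c l z) : ℤ) := by
      rw [rowL_apply, rowL_apply]
      push_cast
      exact SpR.sum _ fun j => (rel_Cqt H i j).mul (ih j)
    by_cases hk : k = i
    · simp only [hk, if_true]
      have := (ih i).sub ((rel_uu d i).mul h1)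
      rw [one_mul] at this
      push_cast
      exact this
    · simp only [hk, if_false, sub_zero]
      exact ih k
end TT

section Conv
variable {ι : Type} [Fintype ι] [DecidableEq ι] {c : ι → ι → ℤ} {d : ι → ℤ}

theorem sZ_eq (c : ι → ι → ℤ) (i : ι) : sZ c i = ⇑(sg c i) := by
  funext v k
  rw [sg_coord, rowL_apply]; rfl

theorem fold_eq (c : ι → ι → ℤ) (l : List ι) :
    (l.map (sZ c)).foldr (· ∘ ·) id = ⇑(sw c l) := by
  induction l with
  | nil => rfl
  | cons i l ih =>
    rw [List.map_cons, List.foldr_cons, ih, sw_cons, sZ_eq]; rfl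

theorem isRt_iff (c : ι → ι → ℤ) (β : ι → ℤ) :
    (∃ w, memW c w ∧ ∃ i, β = w (alphaZ i)) ↔ IsRt c β := by
  constructor
  · rintro ⟨w, ⟨l, rfl⟩, i, h⟩
    rw [fold_eq] at h
    exact ⟨l, i, h⟩
  · rintro ⟨l, i, h⟩
    exact ⟨_, ⟨l, rfl⟩, i, by rw [fold_eq]; exact h⟩

theorem unb (hdiag : ∀ i, c i i = 2) {i j : ι} (hij : i ≠ j) {r : ℤ} (h1 : c i j = -r) (h2 : c j i = -1)
    (hr : 4 ≤ r) (k : ℕ) : ∃ (l : List ι) (p p' : ℤ),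
      sw c l (Pi.single i 1) = p • Pi.single i 1 + p' • Pi.single j 1 ∧ 2 * p' ≤ p - 1 ∧ (k : ℤ) + 1 ≤ p := by
  induction k with
  | zero => exact ⟨[], 1, 0, by simp, by norm_num, by norm_num⟩
  | succ k ih =>
    obtain ⟨l, p, p', e, a, b⟩ := ih
    refine ⟨i :: j :: l, (r - 1) * p - r * p', p - p', ?_, ?_, ?_⟩
    · rw [sw_cons, sw_cons, Module.End.mul_apply, Module.End.mul_apply, e]
      simp only [map_add, map_sub, map_smul, sg_other, hdiag, h1, h2, smul_sub]
      module
    · nlinarith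
    · push_cast; nlinarith

theorem mkCH {r : ℤ} {θ : ι → ℤ} (hdiag : ∀ i, c i i = 2)
    (hdpos : ∀ i, 0 < d i)
    (hsymm : ∀ i j, d i * c i j = d j * c j i)
    (honer : ∀ i, d i = 1 ∨ d i = r)
    (hrmax : ∀ i, d i ≤ r)
    (hbmax : ∀ i j, i ≠ j → c i j ≠ 0 → d i * c i j = -(max (d i) (d j)))
    (hθ : ∀ β : ι → ℤ, IsRt c β → ∀ k, β k ≤ θ k) : CH c d := by
  refine ⟨hdiag, hdpos, hsymm, ?_⟩
  have key : ∀ i j, i ≠ j → c i j = -r → c j i = -1 → r < 4 := by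
    intro i j hij h1 h2
    by_contra hr
    push Not at hr
    obtain ⟨l, p, p', e, a, b⟩ := unb hdiag hij h1 h2 hr (θ i).natAbs
    have := hθ _ ⟨l, i, rfl⟩ i
    rw [e] at this
    simp [hij] at this
    have h3 : θ i ≤ (θ i).natAbs := Int.le_natAbs
    omega
  intro i j hij
  by_cases h0 : c i j = 0
  · left
    refine ⟨h0, ?_⟩
    have := hsymm i j
    rw [h0, mul_zero] at this
    have := hdpos j
    rcases mul_eq_zero.1 (by assumption : 0 = d j * c j i).symm with h | h
    · omega
    · exact h
  right
  have h0' : c j i ≠ 0 := by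
    intro h
    have := hsymm i j
    rw [h, mul_zero] at this
    rcases mul_eq_zero.1 this with h | h
    · have := hdpos i; omega
    · exact h0 h
  have b1 := hbmax i j hij h0
  have b2 := hbmax j i hij.symm h0'
  have pi := hdpos i
  have pj := hdpos j
  by_cases he : d i = d j
  · left
    rw [he, max_self] at b1
    rw [← he, max_self] at b2
    refine ⟨he, ?_, ?_⟩
    · have : d j * (c i j + 1) = 0 := by linarith
      rcases mul_eq_zero.1 this with h | h <;> omega
    · have : d i * (c j i + 1) = 0 := by linarith
      rcases mul_eq_zero.1 this with h | h <;> omega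
  right
  have main : ∀ i j, i ≠ j → d i = 1 → d j = r → r ≠ 1 → d i * c i j = -(max (d i) (d j)) →
      d j * c j i = -(max (d j) (d i)) → c i j = -r ∧ c j i = -1 ∧ (r = 2 ∨ r = 3) := by
    intro i j hij e1 e2 hr b1 b2
    have hp := hdpos j
    rw [e1, e2, max_eq_right (by omega)] at b1
    rw [e1, e2, max_eq_left (by omega)] at b2
    have x1 : c i j = -r := by omega
    have x2 : c j i = -1 := by
      have : r * (c j i + 1) = 0 := by linarith
      rcases mul_eq_zero.1 this with h | h <;> omega
    have := key i j hij x1 x2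
    exact ⟨x1, x2, by omega⟩
  rcases honer i with hi | hi <;> rcases honer j with hj | hj
  · omega
  · obtain ⟨x1, x2, rfl | rfl⟩ := main i j hij hi hj (by omega) b1 b2
    · simp [hi, hj, x1, x2]
    · simp [hi, hj, x1, x2]
  · obtain ⟨x1, x2, rfl | rfl⟩ := main j i hij.symm hj hi (by omega) b2 b1
    · simp [hi, hj, x1, x2]
    · simp [hi, hj, x1, x2]
  · omega

theorem mkΦ (hWfin : {w : (ι → ℤ) → (ι → ℤ) | memW c w}.Finite) :
    ∃ Φ : Finset (ι → ℤ), ∀ β, β ∈ Φ ↔ IsRt c β := by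
  have : {β | IsRt c β}.Finite := by
    have h := (hWfin.prod (Set.finite_univ (α := ι))).image (fun x => x.1 (alphaZ x.2))
    refine h.subset ?_
    intro β hβ
    obtain ⟨w, hw, i, e⟩ := (isRt_iff c β).2 hβ
    exact ⟨(w, i), ⟨hw, Set.mem_univ _⟩, e.symm⟩
  exact ⟨this.toFinset, by simp⟩

theorem Bform_left (i : ι) (v : ι → KK) :
    Bform c d (Pi.single i 1) v = qint (d i) * rowL (Cqt c d) i v := by
  simp only [Bform, rowL_apply, Pi.single_apply, Finset.mul_sum]
  rw [Finset.sum_eq_single i]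
  · refine Finset.sum_congr rfl fun j _ => ?_
    simp; ring
  · intro k _ hk
    simp [hk]
  · simp

theorem Trefl_eq (H : CH c d) (i : ι) : Trefl c d i = ⇑(gr (Cqt c d) (uu d) i) := by
  funext v k
  have : qint (d i) ≠ 0 := qint_ne (H.dpos i).ne'
  rw [gr_apply]
  simp only [Trefl, alphaK, Bform_left, Pi.sub_apply, Pi.smul_apply, smul_eq_mul, uu]
  field_simp

theorem Tfold_eq (H : CH c d) (l : List ι) (v : ι → KK) :
    l.foldr (fun a acc => Trefl c d a acc) v = gw (Cqt c d) (uu d) l v := by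
  induction l with
  | nil => rfl
  | cons i l ih => rw [List.foldr_cons, ih, Trefl_eq H, gw_cons]; rfl
end Conv

section Main
variable {ι : Type} [Fintype ι] [DecidableEq ι]
variable {c : ι → ι → ℤ} {d : ι → ℤ} {r : ℤ} {Φ : Finset (ι → ℤ)} {θ : ι → ℤ}
    {ww : List ι} {st : ι → ι}

theorem bf_neg_neg (v w : ι → ℤ) : bf c d (-v) (-w) = bf c d v w := by simp [bf]

theorem CD.st_bf (D : CD c d r Φ θ ww st) (i j : ι) :
    d (st i) * c (st i) (st j) = d i * c i j := by
  have h := bf_inv_w D.H ww (Pi.single i 1) (Pi.single j 1)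
  rw [D.hst, D.hst, bf_neg_neg, bf_single, bf_single, rowL_single, rowL_single] at h
  exact h

theorem CD.st_d (D : CD c d r Φ θ ww st) (i : ι) : d (st i) = d i := by
  have h := D.st_bf i i
  rw [D.H.diag, D.H.diag] at h
  omega

theorem CD.st_c (D : CD c d r Φ θ ww st) (i j : ι) : c (st i) (st j) = c i j := by
  have h := D.st_bf i j
  rw [D.st_d] at h
  exact mul_left_cancel₀ (D.H.dpos i).ne' h

theorem CD.st_u (D : CD c d r Φ θ ww st) (i : ι) : uu d (st i) = uu d i := by
  simp only [uu, D.st_d]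

theorem CD.st_A (D : CD c d r Φ θ ww st) (hinv : Function.Involutive st) (i j : ι) :
    Cqt c d (st i) (st j) = Cqt c d i j := by
  simp only [Cqt, hinv.injective.eq_iff, D.st_d, D.st_c]

theorem CD.st_sg (D : CD c d r Φ θ ww st) (i : ι) : sw c ww * sg c i = sg c (st i) * sw c ww := by
  refine LinearMap.ext fun v => ?_
  rw [Module.End.mul_apply, Module.End.mul_apply, sg_apply, sg_apply, map_sub, map_smul, D.hst]
  have h := bf_inv_w D.H ww (Pi.single i 1) v
  rw [D.hst, ← neg_neg (sw c ww v), bf_neg_neg, bf_single, bf_single, D.st_d, map_neg] at h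
  have h2 := mul_left_cancel₀ (D.H.dpos i).ne' h
  rw [← h2]
  simp

theorem CD.comm (D : CD c d r Φ θ ww st) (hr : Rd c ww) (i : ι) :
    gw (Cqt c d) (uu d) ww * gr (Cqt c d) (uu d) i =
      gr (Cqt c d) (uu d) (st i) * gw (Cqt c d) (uu d) ww := by
  have h1 : ¬ 0 ≤ sw c ww (Pi.single i 1) := by
    rw [D.hst]
    intro h
    have := h (st i)
    simp at this
  obtain ⟨b, hb, hl⟩ := drop_last D.H hr (not_rd_neg D.H h1)
  have hb2 : sw c (st i :: b) = sw c ww := by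
    rw [sw_cons]
    have : sw c b = sw c ww * sg c i := by
      rw [← hb, sw_snoc, mul_assoc, sg_sq D.H, mul_one]
    rw [this, ← mul_assoc, ← D.st_sg, mul_assoc, sg_sq D.H, mul_one]
  have hbr : ∀ i j, i ≠ j → gw (Cqt c d) (uu d) (alt i j (mm c i j)) =
      gw (Cqt c d) (uu d) (alt j i (mm c i j)) := fun i j h => T_braid D.H h
  have e1 := matsumoto (Cqt c d) (uu d) D.H hbr ww.length ww (b ++ [i]) rfl (by simpa using hl) hr hb.symm
  have e2 := matsumoto (Cqt c d) (uu d) D.H hbr ww.length ww (st i :: b) rfl (by simpa using hl) hr hb2.symm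
  have e3 : gw (Cqt c d) (uu d) (b ++ [i]) = gw (Cqt c d) (uu d) b * gr (Cqt c d) (uu d) i := by simp
  rw [gw_cons] at e2
  rw [e3] at e1
  conv_rhs => rw [e1]
  rw [e2, mul_assoc]

theorem CD.eig [Nonempty ι] (D : CD c d r Φ θ ww st) (hr : Rd c ww) (hinv : Function.Involutive st) :
    ∃ ν : KK, ∀ (v : ι → KK) (k : ι), gw (Cqt c d) (uu d) ww v k = ν * v (st k) := by
  set 𝒯 := gw (Cqt c d) (uu d) ww with h𝒯
  have h1 : ∀ (i : ι) (v : ι → KK), rowL (Cqt c d) i v • 𝒯 (Pi.single i 1) =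
      rowL (Cqt c d) (st i) (𝒯 v) • (Pi.single (st i) 1 : ι → KK) := by
    intro i v
    have h := congrArg (fun f : Module.End KK (ι → KK) => f v) (D.comm hr i)
    simp only [Module.End.mul_apply, gr_apply, map_sub, map_smul, ← h𝒯, D.st_u, sub_right_inj, mul_smul] at h
    have := congrArg (fun x => (uu d i)⁻¹ • x) h
    simpa [smul_smul, uu_ne] using this
  have h2 : ∀ i, ∃ ν : KK, 𝒯 (Pi.single i 1) = ν • (Pi.single (st i) 1 : ι → KK) := by
    intro i
    have hA : Cqt c d i i ≠ 0 := (rel_Cqt D.H i i).ne (by rw [D.H.diag]; norm_num)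
    have h := h1 i (Pi.single i 1)
    rw [rowL_single] at h
    refine ⟨(Cqt c d i i)⁻¹ * rowL (Cqt c d) (st i) (𝒯 (Pi.single i 1)), ?_⟩
    rw [mul_smul, ← h, smul_smul, inv_mul_cancel₀ hA, one_smul]
  choose ν hν using h2
  have h3 : ∀ i j, c i j ≠ 0 → ν i = ν j := by
    intro i j hc
    have hA : Cqt c d i j ≠ 0 := (rel_Cqt D.H i j).ne (by exact_mod_cast hc)
    have h := h1 i (Pi.single j 1)
    rw [rowL_single, hν, hν, map_smul, rowL_single, D.st_A hinv] at h
    have h := congrFun h (st i)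
    simp at h
    rw [mul_comm (ν j)] at h
    exact mul_left_cancel₀ hA h
  have h4 : ∀ i j, ν i = ν j := by
    intro i j
    have := D.hconn i j
    induction this with
    | refl => rfl
    | tail _ hbc ih => rw [ih]; exact h3 _ _ hbc.2
  obtain ⟨i0⟩ := ‹Nonempty ι›
  refine ⟨ν i0, fun v k => ?_⟩
  have hv : v = ∑ i, v i • (Pi.single i 1 : ι → KK) := by
    funext k; simp [Finset.sum_apply, Pi.single_apply]
  conv_lhs => rw [hv]
  rw [map_sum, Finset.sum_apply, Finset.sum_eq_single (st k)]
  · rw [map_smul, hν, h4 _ i0, hinv k]; simp [mul_comm]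
  · intro i _ hi
    rw [map_smul, hν]
    have : k ≠ st i := fun h => hi (by rw [h, hinv i])
    simp [this]
  · simp

theorem det_gw (l : List ι) : (LinearMap.det (gw (Cqt c d) (uu d) l)) ^ 2 =
    qv ^ (-(4 * (l.map d).sum)) * tv ^ (4 * (l.length : ℤ)) := by
  induction l with
  | nil => simp
  | cons i l ih =>
    rw [gw_cons, map_mul, mul_pow, ih, gr_det, u_diag, List.map_cons, List.sum_cons, List.length_cons]
    have hu : (1 - (1 + uu d i ^ 2)) ^ 2 = qv ^ (-(4 * d i)) * tv ^ (4:ℤ) := by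
      have : (1 - (1 + uu d i ^ 2)) ^ 2 = uu d i ^ (4:ℤ) := by norm_cast; ring
      rw [this, uu, mul_zpow, ← zpow_mul]
      congr 2; ring
    rw [hu]
    push_cast
    rw [mul_add 4 (d i), neg_add, zpow_add₀ qv_ne, mul_add 4 (l.length : ℤ), zpow_add₀ tv_ne, mul_one]
    ring

theorem CD.nu [Nonempty ι] (D : CD c d r Φ θ ww st) (hr : Rd c ww) (hinv : Function.Involutive st)
    {ν : KK} (h : ∀ (v : ι → KK) (k : ι), gw (Cqt c d) (uu d) ww v k = ν * v (st k)) :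
    ν * (qv ^ (r + ∑ k, θ k * d k) * tv ^ (-(1 + ∑ k, θ k))) = -1 := by
  obtain ⟨hN, hh⟩ := D.sums hr
  set N := r + ∑ k, θ k * d k
  set hc := 1 + ∑ k, θ k
  set n := Fintype.card ι with hn
  have hn0 : 0 < n := Fintype.card_pos
  have hrel : SpR ν (-1) := by
    obtain ⟨i⟩ := ‹Nonempty ι›
    have h1 := rel_tw D.H ww (v := Pi.single i 1) (z := Pi.single i 1) (by
      intro k
      by_cases hk : k = i
      · subst hk; simpa using rel_one
      · simpa [hk] using rel_zero) (st i)
    rw [h, hinv i, D.hst] at h1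
    simpa using h1
  have hsq : gw (Cqt c d) (uu d) ww * gw (Cqt c d) (uu d) ww = (ν ^ 2) • (1 : Module.End KK (ι → KK)) := by
    refine LinearMap.ext fun v => funext fun k => ?_
    rw [Module.End.mul_apply, h, h, hinv k]
    simp; ring
  have hdet := congrArg LinearMap.det hsq
  rw [map_mul, ← pow_two, det_gw, LinearMap.det_smul, map_one, mul_one, Module.finrank_fintype_fun_eq_card,
    ← hn] at hdet
  rw [show 4 * (ww.map d).sum = 2 * (n * N) by rw [← hN]; ring,
    show 4 * (ww.length : ℤ) = 2 * (n * hc) by rw [← hh]; ring] at hdet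
  set y : KK := -(ν * (qv ^ N * tv ^ (-hc))) with hy
  have hyr : SpR y 1 := by
    have := (hrel.mul ((rel_q.zpow1 N).mul (rel_t.zpow1 (-hc)))).neg
    simpa [hy] using this
  have hy1 : y ^ (2 * n) = 1 := by
    rw [hy, pow_mul, neg_sq, ← pow_mul, mul_pow, pow_mul, ← hdet, mul_pow]
    rw [← zpow_natCast, ← zpow_natCast, ← zpow_mul, ← zpow_mul]
    push_cast
    have e1 : qv ^ (-(2 * (n * N))) * qv ^ (N * (2 * n)) = 1 := by
      rw [← zpow_add₀ qv_ne]
      rw [show -(2 * (n * N)) + N * (2 * (n:ℤ)) = 0 by ring, zpow_zero]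
    have e2 : tv ^ (2 * (n * hc)) * tv ^ (-hc * (2 * n)) = 1 := by
      rw [← zpow_add₀ tv_ne]
      rw [show (2 * (n * hc)) + -hc * (2 * (n:ℤ)) = 0 by ring, zpow_zero]
    linear_combination tv ^ (2 * (n * hc)) * tv ^ (-hc * (2 * n)) * e1 + e2
  have hg : SpR (∑ k ∈ Finset.range (2 * n), y ^ k) (∑ k ∈ Finset.range (2 * n), (1:ℚ) ^ k) :=
    SpR.sum _ fun k => hyr.pow k
  have hg0 := hg.ne (by simp; omega)
  have hz := mul_geom_sum y (2 * n)
  rw [hy1, sub_self] at hz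
  have : y - 1 = 0 := (mul_eq_zero.1 hz).resolve_right hg0
  rw [hy] at this
  linear_combination -this

theorem telescope (A : ι → ι → KK) (u : ι → KK) (v : ι → KK) (l : List ι) :
    v - gw A u l v = ∑ k : Fin l.length, (u (l.get k) * rowL A (l.get k) v) •
      gw A u (l.take k.1) (Pi.single (l.get k) 1) := by
  induction l with
  | nil => simp
  | cons i l ih =>
    have e : v - gw A u (i :: l) v = (v - gr A u i v) + gr A u i (v - gw A u l v) := by
      rw [gw_cons, Module.End.mul_apply, map_sub]; abel
    rw [e, ih, gr_apply A u i v, sub_sub_cancel, map_sum]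
    simp only [List.length_cons]
    rw [Fin.sum_univ_succ]
    congr 1
    refine Finset.sum_congr rfl fun k _ => ?_
    simp [Module.End.mul_apply]

theorem sig_qint (σ : KK ≃+* KK) (hσq : σ qv = qv⁻¹) (k : ℤ) : σ (qint k) = qint k := by
  have h := qq_ne
  have h' : qv⁻¹ - qv ≠ 0 := by intro h0; apply h; rw [← neg_sub, h0, neg_zero]
  simp only [qint, map_div₀, map_sub, map_zpow₀, map_inv₀, hσq, inv_inv, inv_zpow', neg_neg]
  rw [div_eq_div_iff h' h]; ring

theorem sig_u (σ : KK ≃+* KK) (hσq : σ qv = qv⁻¹) (hσt : σ tv = tv⁻¹) (i : ι) :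
    σ (uu d i) = (uu d i)⁻¹ := by
  simp only [uu, map_mul, map_zpow₀, hσq, hσt, mul_inv, inv_zpow]

theorem sig_A (σ : KK ≃+* KK) (hσq : σ qv = qv⁻¹) (hσt : σ tv = tv⁻¹) (i j : ι) :
    σ (Cqt c d i j) = Cqt c d i j := by
  by_cases h : i = j
  · subst h
    rw [Cqt_diag, map_add, map_inv₀, sig_u σ hσq hσt, inv_inv, add_comm]
  · rw [Cqt_off h, sig_qint σ hσq]

theorem CD.final [Nonempty ι] (D : CD c d r Φ θ ww st) (hr : Rd c ww) (hinv : Function.Involutive st)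
    (mu : ι → ι → KK)
    (hmu : ∀ i j, Bform c d (mu i) (alphaK j) = if i = j then 1 else 0)
    (σ : KK ≃+* KK) (hσq : σ qv = qv⁻¹) (hσt : σ tv = tv⁻¹) (i j : ι) :
      (1 - qv ^ (2 * (r + ∑ k, θ k * d k)) * tv ^ (-(2 * (1 + ∑ k, θ k)))) *
          ((Matrix.of (Cqt c d))⁻¹ i j) =
        qv ^ (d j) * tv⁻¹ *
          (σ (Pij c d ww mu i j) -
            qv ^ (r + ∑ k, θ k * d k) * tv ^ (-(1 + ∑ k, θ k)) *
              σ (Pij c d ww mu i (st j))) := by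
  obtain ⟨ν, hν⟩ := D.eig hr hinv
  have hQ := D.nu hr hinv hν
  have hQ2 : qv ^ (2 * (r + ∑ k, θ k * d k)) * tv ^ (-(2 * (1 + ∑ k, θ k))) =
      (qv ^ (r + ∑ k, θ k * d k) * tv ^ (-(1 + ∑ k, θ k))) ^ 2 := by
    rw [mul_pow, ← zpow_natCast, ← zpow_natCast, ← zpow_mul, ← zpow_mul]
    congr 2 <;> push_cast <;> ring
  have hσQ : σ (qv ^ (r + ∑ k, θ k * d k) * tv ^ (-(1 + ∑ k, θ k))) =
      (qv ^ (r + ∑ k, θ k * d k) * tv ^ (-(1 + ∑ k, θ k)))⁻¹ := by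
    simp only [map_mul, map_zpow₀, hσq, hσt, mul_inv, inv_zpow]
  have hQ0 : qv ^ (r + ∑ k, θ k * d k) * tv ^ (-(1 + ∑ k, θ k)) ≠ 0 :=
    mul_ne_zero (zpow_ne_zero _ qv_ne) (zpow_ne_zero _ tv_ne)
  rw [hQ2]
  generalize qv ^ (r + ∑ k, θ k * d k) * tv ^ (-(1 + ∑ k, θ k)) = Q at hQ hσQ hQ0 ⊢
  have hσν : σ ν = -Q := by
    have := congrArg σ hQ
    rw [map_mul, hσQ, map_neg, map_one] at this
    field_simp at this
    exact this
  have hB : ∀ i (v : ι → KK), Bform c d (mu i) v = ∑ j, v j * Bform c d (mu i) (alphaK j) := by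
    intro i v
    simp only [Bform, alphaK]
    rw [Finset.sum_comm]
    refine Finset.sum_congr rfl fun j _ => ?_
    rw [Finset.mul_sum]
    refine Finset.sum_congr rfl fun k _ => ?_
    rw [Finset.sum_eq_single j]
    · simp; ring
    · intro b _ hb; simp [hb]
    · simp
  have hB2 : ∀ i (v : ι → KK), Bform c d (mu i) v = v i := by
    intro i v
    rw [hB]; simp [hmu]
  set M := Matrix.of (Cqt c d) with hM
  set X : Matrix ι ι KK := Matrix.of fun i k => mu i k * qint (d k) with hX
  have hXM : X * M = 1 := by
    ext a b
    rw [Matrix.mul_apply, Matrix.one_apply, ← hmu a b]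
    simp only [Bform, alphaK]
    refine Finset.sum_congr rfl fun k _ => ?_
    rw [Finset.sum_eq_single b]
    · simp [hX, hM]; ring
    · intro b' _ hb; simp [hb]
    · simp
  have hMi : M⁻¹ * M = 1 := by rw [Matrix.inv_eq_left_inv hXM, hXM]
  have hMi' : M * M⁻¹ = 1 := mul_eq_one_comm.1 hMi
  have hrow : ∀ a b, rowL (Cqt c d) a (fun k => M⁻¹ k b) = if a = b then 1 else 0 := by
    intro a b
    have := congrFun (congrFun hMi' a) b
    rw [Matrix.mul_apply, Matrix.one_apply] at this
    rw [rowL_apply]; exact this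
  have hst : ∀ a b, M⁻¹ (st a) b = M⁻¹ a (st b) := by
    intro a b
    have h1 : M.submatrix (hinv.toPerm st) (hinv.toPerm st) = M := by
      ext a b; exact D.st_A hinv a b
    have h2 := Matrix.inv_submatrix_equiv M (hinv.toPerm st) (hinv.toPerm st)
    rw [h1] at h2
    have h3 := congrFun (congrFun h2 (st a)) b
    rw [h3]
    simp only [Matrix.submatrix_apply]
    show M⁻¹ (st (st a)) (st b) = _
    rw [hinv a]
  have hσX : ∀ a b, σ (M⁻¹ a b) = M⁻¹ a b := by
    have h1 : (M⁻¹.map σ) * M = 1 := by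
      have h2 : M.map σ = M := by ext a b; exact sig_A σ hσq hσt a b
      have h3 := congrArg (fun Z : Matrix ι ι KK => Z.map σ) hMi
      simp only [Matrix.map_mul, h2] at h3
      rw [h3]
      ext a b
      simp [Matrix.one_apply, apply_ite σ]
    have h4 := Matrix.inv_eq_left_inv h1
    intro a b
    exact (congrFun (congrFun h4 a) b).symm
  have hE : ∀ b, M⁻¹ i b - ν * M⁻¹ i (st b) = uu d b * Pij c d ww mu i b := by
    intro b
    have h := congrFun (telescope (Cqt c d) (uu d) (fun k => M⁻¹ k b) ww) i
    rw [Pi.sub_apply, hν, hst] at h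
    rw [h, Finset.sum_apply, Pij, Finset.mul_sum]
    refine Finset.sum_congr rfl fun k _ => ?_
    rw [hrow]
    by_cases hk : ww.get k = b
    · rw [if_pos hk, if_pos hk, hB2, Tfold_eq D.H, hk]
      simp [alphaK]
    · rw [if_neg hk, if_neg hk]; simp
  have hE2 : ∀ b, M⁻¹ i b + Q * M⁻¹ i (st b) = (uu d b)⁻¹ * σ (Pij c d ww mu i b) := by
    intro b
    have := congrArg σ (hE b)
    rw [map_sub, map_mul, map_mul, hσX, hσX, hσν, sig_u σ hσq hσt] at this
    rw [← this]; ring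
  have f1 := hE2 j
  have f2 := hE2 (st j)
  rw [hinv j, D.st_u] at f2
  have hu : (uu d j)⁻¹ = qv ^ (d j) * tv⁻¹ := by
    simp only [uu, mul_inv, zpow_neg, inv_inv]
  rw [← hu]
  linear_combination f1 - Q * f2
end Main

theorem statement_9
    {I : Type} [Fintype I] [DecidableEq I] [Nonempty I]
    (c : I → I → ℤ) (d : I → ℤ) (r : ℤ)
    -- `C` is a symmetrizable generalized Cartan matrix
    (hdiag : ∀ i, c i i = 2)
    (hoff : ∀ i j, i ≠ j → c i j ≤ 0)
    -- `(d_i)` are positive integers with gcd 1 symmetrizing `C`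
    (hdpos : ∀ i, 0 < d i)
    (hgcd : Finset.univ.gcd d = 1)
    (hsymm : ∀ i j, d i * c i j = d j * c j i)
    -- each `d_i ∈ {1, r}` where `r = max_i d_i`
    (honer : ∀ i, d i = 1 ∨ d i = r)
    (hrmax : ∀ i, d i ≤ r)
    (hrmem : ∃ i, d i = r)
    -- `d_i c_{ij} = -max(d_i, d_j)` whenever `i ≠ j` and `c_{ij} ≠ 0`
    (hbmax : ∀ i j, i ≠ j → c i j ≠ 0 → d i * c i j = -(max (d i) (d j)))
    -- `C` is indecomposable
    (hconn : ∀ i j : I, Relation.ReflTransGen (fun a b => a ≠ b ∧ c a b ≠ 0) i j)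
    -- `C` is of finite type: the Weyl group is finite
    (hWfin : {w : (I → ℤ) → (I → ℤ) | memW c w}.Finite)
    -- `θ = Σ a_i α_i` is the highest root: `θ ∈ Φ` and `θ - β ∈ Q₊` for all `β ∈ Φ`;
    -- then `h = 1 + Σ a_i` and `N = r + Σ a_i d_i = r h^∨`
    (θ : I → ℤ)
    (hθΦ : ∃ w, memW c w ∧ ∃ i, θ = w (alphaZ i))
    (hθhigh : ∀ β : I → ℤ, (∃ w, memW c w ∧ ∃ i, β = w (alphaZ i)) → ∀ k, β k ≤ θ k)
    -- `w₀` is the longest element: `w₀ ∈ W` with `w₀(α_i) ∈ -Q₊` for all `i`,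
    -- and `i ↦ i^*` is the involution with `w₀(α_i) = -α_{i^*}`
    (w0 : (I → ℤ) → (I → ℤ))
    (hw0W : memW c w0)
    (hw0neg : ∀ i k, w0 (alphaZ i) k ≤ 0)
    (istar : I → I)
    (hstar : ∀ i, w0 (alphaZ i) = -alphaZ (istar i))
    (hstarinv : Function.Involutive istar)
    -- `ww = (i₁, …, i_l)` is a reduced expression of `w₀`
    (ww : List I)
    (hred : (ww.map (sZ c)).foldr (· ∘ ·) id = w0)
    (hmin : ∀ vv : List I, (vv.map (sZ c)).foldr (· ∘ ·) id = w0 → ww.length ≤ vv.length)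
    -- `μ_i` is the deformed fundamental coweight: `B(μ_i, α_j) = δ_{ij}`
    (mu : I → I → KK)
    (hmu : ∀ i j, Bform c d (mu i) (alphaK j) = if i = j then 1 else 0)
    -- the bar involution: the field automorphism of `K` with `q̄ = q⁻¹`, `t̄ = t⁻¹`
    (σ : KK ≃+* KK)
    (hσq : σ qv = qv⁻¹)
    (hσt : σ tv = tv⁻¹)
    :
    ∀ i j : I,
      (1 - qv ^ (2 * (r + ∑ k, θ k * d k)) * tv ^ (-(2 * (1 + ∑ k, θ k)))) *
          ((Matrix.of (Cqt c d))⁻¹ i j) =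
        qv ^ (d j) * tv⁻¹ *
          (σ (Pij c d ww mu i j) -
            qv ^ (r + ∑ k, θ k * d k) * tv ^ (-(1 + ∑ k, θ k)) *
              σ (Pij c d ww mu i (istar j)))
    := by
  classical
  have hθ' : ∀ β : I → ℤ, IsRt c β → ∀ k, β k ≤ θ k :=
    fun β h => hθhigh β ((isRt_iff c β).2 h)
  have H : CH c d := mkCH hdiag hdpos hsymm honer hrmax hbmax hθ'
  obtain ⟨Φ, hΦ⟩ := mkΦ hWfin
  have hw : ⇑(sw c ww) = w0 := by rw [← fold_eq]; exact hred
  have D : CD c d r Φ θ ww istar :=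
    { H := H
      hΦ := hΦ
      hconn := hconn
      hrmax := hrmax
      hrmem := hrmem
      hθ := (hΦ θ).2 ((isRt_iff c θ).1 hθΦ)
      hmax := fun β hβ => hθ' β ((hΦ β).1 hβ)
      hst := by intro i; rw [hw]; exact hstar i }
  have hr : Rd c ww := by
    intro b hb
    refine hmin b ?_
    rw [fold_eq, hb, hw]
  exact D.final hr hstarinv mu hmu σ hσq hσt
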